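/- arXiv:1610.08370 — 2 statements merged into one kernel-verified Lean document; each statement's English description precedes it below -/
import Mathlib

section
/- Let G be a connected threshold graph on vertex set {0,1,…,n} (n≥1) labeled by reverse degree sequence, and let a=(a_1,…,a_n) be positive integers. For a spanning tree T of G rooted at 0, let p_T(i) denote the parent of vertex i in T, let Inv(T) denote the set of inversions of T, and define w(T) = ∏_{{i,j}∈E(T)} [a_{max{i,j}}]_q · ∏_{(i,j)∈Inv(T)} q^{a_{max{p_T(i),j}}}. Then Ehr_{q,1}(F_G(a)) = Σ_T w(T), summed over all spanning trees T of G. -/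
open Finset Polynomial

namespace ThresholdFlow

/-- A threshold graph on `{0,…,n}` labeled by reverse degree sequence: whenever `i > j` are
adjacent and `i' ≤ i`, `j' ≤ j`, `i' ≠ j'`, then `i'` and `j'` are adjacent. -/
def IsThreshold (n : ℕ) (G : SimpleGraph (Fin (n+1))) : Prop :=
  ∀ i j i' j' : Fin (n+1), j < i → G.Adj i j → i' ≤ i → j' ≤ j → i' ≠ j' → G.Adj i' j'

/-- An integer `a`-flow on `G`: nonnegative integers on the edges of `G` (oriented from the
larger endpoint `i` to the smaller endpoint `j`, recorded as `f i j`), with net flow `a i`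
at every vertex `i ≠ 0`. -/
def IsFlow (n : ℕ) (G : SimpleGraph (Fin (n+1))) (a : Fin (n+1) → ℕ)
    (f : Fin (n+1) → Fin (n+1) → ℕ) : Prop :=
  (∀ i j, f i j ≠ 0 → j < i ∧ G.Adj i j) ∧
  (∀ i : Fin (n+1), i ≠ 0 → ∑ j, f i j = a i + ∑ j, f j i)

/-- The number of positive entries of a flow. -/
def posCount (n : ℕ) (f : Fin (n+1) → Fin (n+1) → ℕ) : ℕ :=
  (Finset.univ.filter fun pr : Fin (n+1) × Fin (n+1) => 0 < f pr.1 pr.2).card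

/-- `[b]_q = 1 + q + ⋯ + q^(b-1)` as a polynomial in `ℤ[q]`. -/
noncomputable def qnat (b : ℕ) : Polynomial ℤ := ∑ k ∈ Finset.range b, X ^ k

/-- `Ehr_{q,1}(F_G(a))`: the sum over integer `a`-flows with exactly `n` positive entries of
`∏_{e : f(e) > 0} [f(e)]_q`. -/
noncomputable def Ehr1 (n : ℕ) (G : SimpleGraph (Fin (n+1))) (a : Fin (n+1) → ℕ) :
    Polynomial ℤ :=
  ∑ᶠ f ∈ {f | IsFlow n G a f ∧ posCount n f = n},
    ∏ i, ∏ j, if 0 < f i j then qnat (f i j) else 1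

/-- `Ehr_{q,0}(F_G(a))`: the sum over all integer `a`-flows of
`(q-1)^(s(f)-n) ∏_{e : f(e) > 0} q^(f(e)-1)`. -/
noncomputable def Ehr0 (n : ℕ) (G : SimpleGraph (Fin (n+1))) (a : Fin (n+1) → ℕ) :
    Polynomial ℤ :=
  ∑ᶠ f ∈ {f | IsFlow n G a f},
    (X - 1) ^ (posCount n f - n) * ∏ i, ∏ j, if 0 < f i j then X ^ (f i j - 1) else 1

/-- `Ehr_{1,1}(F_G(a))`: the sum over integer `a`-flows with exactly `n` positive entries of
the product of the positive entries. -/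
noncomputable def Ehr11 (n : ℕ) (G : SimpleGraph (Fin (n+1))) (a : Fin (n+1) → ℕ) : ℕ :=
  ∑ᶠ f ∈ {f | IsFlow n G a f ∧ posCount n f = n},
    ∏ i, ∏ j, if 0 < f i j then f i j else 1

/-- A spanning tree of `G` rooted at `0`, encoded by its parent function `p`:
`p 0 = 0`, each `i ≠ 0` is adjacent in `G` to its parent `p i`, and iterating the parent
function from any vertex reaches the root `0`. -/
def IsSpanTree (n : ℕ) (G : SimpleGraph (Fin (n+1))) (p : Fin (n+1) → Fin (n+1)) : Prop :=
  p 0 = 0 ∧ (∀ i, i ≠ 0 → G.Adj i (p i)) ∧ ∀ i, ∃ k, p^[k] i = 0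

/-- `j` is a descendant of `i` in the rooted tree with parent function `p`
(in particular every vertex is a descendant of itself). -/
def Desc (n : ℕ) (p : Fin (n+1) → Fin (n+1)) (i j : Fin (n+1)) : Prop :=
  ∃ k, p^[k] j = i

/-- The set of inversions of the rooted tree `p`: pairs `(i,j)` with `i > j`, `i ≠ 0` and
`j` a descendant of `i`. -/
def invSet (n : ℕ) (p : Fin (n+1) → Fin (n+1)) : Set (Fin (n+1) × Fin (n+1)) :=
  {pr | pr.2 < pr.1 ∧ pr.1 ≠ 0 ∧ Desc n p pr.1 pr.2}

/-- The number of inversions of the rooted tree `p`. -/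
noncomputable def treeInv (n : ℕ) (p : Fin (n+1) → Fin (n+1)) : ℕ := (invSet n p).ncard

/-- A rooted spanning tree is increasing if it has no inversions. -/
def IsIncr (n : ℕ) (p : Fin (n+1) → Fin (n+1)) : Prop := invSet n p = ∅

/-- `δ_T(i)`: the number of descendants of `i` (including `i` itself). -/
noncomputable def delta (n : ℕ) (p : Fin (n+1) → Fin (n+1)) (i : Fin (n+1)) : ℕ :=
  Set.ncard {j | Desc n p i j}

/-- `δ_T^a(i) = Σ_j a_j`, summed over the descendants `j` of `i` (including `i` itself). -/
noncomputable def deltaA (n : ℕ) (a : Fin (n+1) → ℕ) (p : Fin (n+1) → Fin (n+1))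
    (i : Fin (n+1)) : ℕ :=
  ∑ᶠ j ∈ {j | Desc n p i j}, a j

/-- The degree `d_i` of vertex `i` in `G`. -/
noncomputable def deg (n : ℕ) (G : SimpleGraph (Fin (n+1))) (i : Fin (n+1)) : ℕ :=
  Set.ncard {j | G.Adj i j}

/-- `d̄_i`: the number of neighbors of `i` smaller than `i`. -/
noncomputable def dbar (n : ℕ) (G : SimpleGraph (Fin (n+1))) (i : Fin (n+1)) : ℕ :=
  Set.ncard {j | j < i ∧ G.Adj i j}

/-- A `G`-parking function, encoded as `P : Fin (n+1) → ℕ` with `P 0 = 0`. -/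
def IsParking (n : ℕ) (G : SimpleGraph (Fin (n+1))) (P : Fin (n+1) → ℕ) : Prop :=
  P 0 = 0 ∧ ∀ S : Finset (Fin (n+1)), S.Nonempty → (0 : Fin (n+1)) ∉ S →
    ∃ i ∈ S, P i < Set.ncard {j | j ∉ S ∧ G.Adj i j}

/-- `codeg(P) = (|E(G)| - n) - Σ_{i=1}^n P(i)`. -/
noncomputable def codeg (n : ℕ) (G : SimpleGraph (Fin (n+1))) (P : Fin (n+1) → ℕ) : ℕ :=
  (Set.ncard G.edgeSet - n) - ∑ i, P i

/-- `[m]_q` as a Laurent polynomial. -/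
noncomputable def lq (m : ℕ) : LaurentPolynomial ℤ :=
  ∑ k ∈ Finset.range m, LaurentPolynomial.T (k : ℤ)

/-- `[b]_{q^m} = 1 + q^m + ⋯ + q^{m(b-1)}` as a Laurent polynomial. -/
noncomputable def lqpow (m b : ℕ) : LaurentPolynomial ℤ :=
  ∑ k ∈ Finset.range b, LaurentPolynomial.T ((m : ℤ) * k)

/-- `wt_{q,q⁻¹}(b)`: the substitution `t = q⁻¹` in `wt_{q,t}(b) = Σ_{k=0}^{b-1} q^k t^{b-1-k}`,
with `wt_{q,q⁻¹}(0) = 1`. -/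
noncomputable def wtqq (b : ℕ) : LaurentPolynomial ℤ :=
  if b = 0 then 1 else ∑ k ∈ Finset.range b, LaurentPolynomial.T (2 * (k : ℤ) - ((b : ℤ) - 1))

/-- `Ehr_{q,q⁻¹}(F_G(a))`: the sum over all integer `a`-flows `f` of
`(-(1-q)(1-q⁻¹))^(s(f)-n) ∏_e wt_{q,q⁻¹}(f(e))`, as a Laurent polynomial in `q`. -/
noncomputable def Ehrqq (n : ℕ) (G : SimpleGraph (Fin (n+1))) (a : Fin (n+1) → ℕ) :
    LaurentPolynomial ℤ :=
  ∑ᶠ f ∈ {f | IsFlow n G a f},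
    (-((1 - LaurentPolynomial.T 1) * (1 - LaurentPolynomial.T (-1)))) ^ (posCount n f - n) *
      ∏ i, ∏ j, wtqq (f i j)

section Core
variable {V R : Type*} [DecidableEq V] [CommRing R]

def sub1 (B : Finset V) (s : V) : Finset (Finset V) := B.powerset.filter (fun C => s ∈ C)
def sub2 (B : Finset V) (s r : V) : Finset (Finset V) :=
  B.powerset.filter (fun C => s ∈ C ∧ r ∉ C)

theorem mem_sub1 {B C : Finset V} {s : V} : C ∈ sub1 B s ↔ C ⊆ B ∧ s ∈ C := by
  simp [sub1]
theorem mem_sub2 {B C : Finset V} {s r : V} : C ∈ sub2 B s r ↔ C ⊆ B ∧ s ∈ C ∧ r ∉ C := by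
  simp [sub2]

theorem sum_swap_sub (B : Finset V) (r s : V) 
    (F : Finset V → Finset V → R) :
    ∑ A ∈ sub2 B r s, ∑ D ∈ sub1 (B \ A) s, F A D
      = ∑ D ∈ sub2 B s r, ∑ A ∈ sub1 (B \ D) r, F A D := by
  apply Finset.sum_comm'
  intro A D
  simp only [mem_sub1, mem_sub2, Finset.subset_sdiff, Finset.disjoint_left]
  constructor
  · rintro ⟨⟨h1, h2, h3⟩, ⟨h4, h5⟩, h6⟩
    exact ⟨⟨⟨h1, fun x hx hx' => h5 hx' hx⟩, h2⟩, h4, h6, fun h => h5 h h2⟩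
  · rintro ⟨⟨⟨h1, h5⟩, h2⟩, h4, h6, h7⟩
    exact ⟨⟨h1, h2, fun h => h5 h h6⟩, ⟨h4, fun x hx hx' => h5 hx' hx⟩, h6⟩

theorem sum_split_sub (B : Finset V) (r s : V) (F : Finset V → R) :
    ∑ A ∈ sub1 B r, F A =
      ∑ A ∈ sub2 B r s, F A + ∑ A ∈ (sub1 B r).filter (fun A => s ∈ A), F A := by
  rw [← Finset.sum_filter_add_sum_filter_not (sub1 B r) (fun A => s ∈ A), add_comm]
  congr 1
  apply Finset.sum_congr _ (fun _ _ => rfl)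
  ext A
  simp [mem_sub1, mem_sub2, and_assoc]

theorem sum_union_sub (B : Finset V) (r s : V) 
    (F : Finset V → Finset V → R) :
    ∑ A ∈ (sub1 B r).filter (fun A => s ∈ A), ∑ D ∈ sub2 A s r, F (A \ D) D
      = ∑ A ∈ sub2 B r s, ∑ D ∈ sub1 (B \ A) s, F A D := by
  rw [Finset.sum_sigma', Finset.sum_sigma']
  apply Finset.sum_nbij' (fun x => ⟨x.1 \ x.2, x.2⟩) (fun x => ⟨x.1 ∪ x.2, x.2⟩)
  · rintro ⟨A, D⟩ h
    simp only [Finset.mem_sigma, Finset.mem_filter, mem_sub1, mem_sub2, Finset.subset_sdiff] at h ⊢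
    obtain ⟨⟨⟨h1, h2⟩, h3⟩, h4, h5, h6⟩ := h
    refine ⟨⟨Finset.sdiff_subset.trans h1, ?_, ?_⟩, ⟨h4.trans h1, Finset.disjoint_sdiff⟩, h5⟩
    · simp [h2, h6]
    · simp [h5]
  · rintro ⟨A, D⟩ h
    simp only [Finset.mem_sigma, Finset.mem_filter, mem_sub1, mem_sub2, Finset.subset_sdiff] at h ⊢
    obtain ⟨⟨h1, h2, h3⟩, ⟨h4, h5⟩, h6⟩ := h
    refine ⟨⟨⟨Finset.union_subset h1 h4, by simp [h2]⟩, by simp [h6]⟩,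
      Finset.subset_union_right, h6, fun h => Finset.disjoint_left.1 h5 h h2⟩
  · rintro ⟨A, D⟩ h
    simp only [Finset.mem_sigma, Finset.mem_filter, mem_sub1, mem_sub2] at h
    simp [Finset.union_eq_left.2 h.2.1]
  · rintro ⟨A, D⟩ h
    simp only [Finset.mem_sigma, mem_sub1, mem_sub2, Finset.subset_sdiff] at h
    simp only [Finset.union_sdiff_right, Sigma.mk.injEq, heq_eq_eq, and_true]
    exact Finset.sdiff_eq_self_of_disjoint h.2.1.2.symm
  · rintro ⟨A, D⟩ h
    rfl

theorem core (K : Finset V → V → R) (y : Finset V → R) (ex : V → Finset V → R)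
    (ψ : V → V → Finset V → R)
    (h1 : ∀ r, K {r} r = 1) (hy0 : y ∅ = 1)
    (hy : ∀ r B, r ∉ B → y (insert r B) = y B * ex r B)
    (hex0 : ∀ r, ex r ∅ = 1)
    (hex : ∀ r D E, Disjoint D E → ex r (D ∪ E) = ex r D * ex r E)
    (hψ : ∀ r D, r ∉ D → ∑ v ∈ D, ψ v r D = ex r D - 1)
    (hrec : ∀ B r s, r ∈ B → s ∈ B → s ≠ r →
      K B r = ∑ D ∈ sub2 B s r, (∑ v ∈ D, ψ v r D * K D v) * K (B \ D) r)
    (B : Finset V) :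
    (∀ r ∈ B, y B = ∑ A ∈ sub1 B r, K A r * y (B \ A)) ∧
    (∀ r ∈ B, ∀ s ∈ B, K B r = K B s) := by
  induction B using Finset.strongInduction with
  | H B ih =>
  have key : ∀ r ∈ B, y B = ∑ A ∈ sub1 B r, K A r * y (B \ A) := by
    intro r hr
    by_cases hs : ∃ s ∈ B, s ≠ r
    · obtain ⟨s, hs, hsr⟩ := hs
      rw [sum_split_sub B r s]
      have e1 : ∑ A ∈ sub2 B r s, K A r * y (B \ A) =
          ∑ A ∈ sub2 B r s, ∑ D ∈ sub1 (B \ A) s, K A r * (K D s * y ((B \ A) \ D)) := by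
        apply Finset.sum_congr rfl
        intro A hA
        rw [mem_sub2] at hA
        rw [(ih (B \ A) (Finset.sdiff_ssubset hA.1 ⟨r, hA.2.1⟩)).1 s (by simp [hs, hA.2.2]),
          Finset.mul_sum]
      have e2 : ∑ A ∈ (sub1 B r).filter (fun A => s ∈ A), K A r * y (B \ A) =
          ∑ A ∈ (sub1 B r).filter (fun A => s ∈ A), ∑ D ∈ sub2 A s r,
            (fun A' D => K A' r * ((ex r D - 1) * K D s * y ((B \ A') \ D))) (A \ D) D := by
        apply Finset.sum_congr rfl
        intro A hA
        rw [Finset.mem_filter, mem_sub1] at hA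
        rw [hrec A r s hA.1.2 hA.2 hsr, Finset.sum_mul]
        apply Finset.sum_congr rfl
        intro D hD
        rw [mem_sub2] at hD
        have hDB : D ⊂ B := by
          refine Finset.ssubset_iff_subset_ne.2 ⟨hD.1.trans hA.1.1, ?_⟩
          rintro rfl
          exact hD.2.2 hr
        have : ∑ v ∈ D, ψ v r D * K D v = (ex r D - 1) * K D s := by
          rw [← hψ r D hD.2.2, Finset.sum_mul]
          apply Finset.sum_congr rfl
          intro v hv
          rw [(ih D hDB).2 v hv s hD.2.1]
        rw [this]
        have h3 : (B \ (A \ D)) \ D = B \ A := by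
          ext x
          have := @hD.1 x
          simp only [Finset.mem_sdiff]
          tauto
        simp only [h3]
        ring
      have e2' := e2.trans (sum_union_sub B r s
        (fun A' D => K A' r * ((ex r D - 1) * K D s * y ((B \ A') \ D))))
      rw [e1, e2']
      rw [← Finset.sum_add_distrib]
      have e3 : ∀ A, ((∑ D ∈ sub1 (B \ A) s, K A r * (K D s * y ((B \ A) \ D))) +
          ∑ D ∈ sub1 (B \ A) s, K A r * ((ex r D - 1) * K D s * y ((B \ A) \ D))) =
          ∑ D ∈ sub1 (B \ A) s, K A r * (K D s * ex r D * y ((B \ A) \ D)) := by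
        intro A
        rw [← Finset.sum_add_distrib]
        apply Finset.sum_congr rfl
        intros
        ring
      simp only [e3]
      rw [sum_swap_sub B r s]
      have e4 : y B = y (B.erase r) * ex r (B.erase r) := by
        rw [← hy r _ (by simp), Finset.insert_erase hr]
      rw [e4, (ih (B.erase r) (Finset.erase_ssubset hr)).1 s (by simp [hs, hsr]), Finset.sum_mul]
      have e5 : sub1 (B.erase r) s = sub2 B s r := by
        ext D
        simp only [mem_sub1, mem_sub2, Finset.subset_erase]
        tauto
      rw [e5]
      apply Finset.sum_congr rfl
      intro D hD
      rw [mem_sub2] at hD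
      have hDe : D ⊆ B.erase r := Finset.subset_erase.2 ⟨hD.1, hD.2.2⟩
      have e6 : ex r (B.erase r) = ex r D * ex r (B.erase r \ D) := by
        rw [← hex r _ _ Finset.disjoint_sdiff, Finset.union_sdiff_of_subset hDe]
      have e7 : y (B.erase r \ D) * ex r (B.erase r \ D) = y (B \ D) := by
        rw [← hy r _ (by simp)]
        congr 1
        ext x
        simp only [Finset.mem_insert, Finset.mem_sdiff, Finset.mem_erase]
        by_cases hx : x = r
        · subst hx; simp [hr, hD.2.2]
        · simp [hx]
      have e8 := (ih (B \ D) (Finset.sdiff_ssubset hD.1 ⟨s, hD.2.1⟩)).1 r (by simp [hr, hD.2.2])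
      calc K D s * y (B.erase r \ D) * ex r (B.erase r)
          = K D s * ex r D * (y (B.erase r \ D) * ex r (B.erase r \ D)) := by rw [e6]; ring
        _ = _ := by
          rw [e7, e8, Finset.mul_sum]
          apply Finset.sum_congr rfl
          intro A _
          rw [sdiff_right_comm]
          ring
    · push Not at hs
      have : B = {r} := by
        ext x
        simp only [Finset.mem_singleton]
        exact ⟨hs x, fun h => h ▸ hr⟩
      subst this
      have e : sub1 {r} r = {{r}} := by
        ext C
        simp only [mem_sub1, Finset.mem_singleton, Finset.subset_singleton_iff]
        constructor
        · rintro ⟨rfl | rfl, h⟩ <;> simp_all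
        · rintro rfl; simp
      rw [e]
      have := hy r ∅ (by simp)
      simp only [hy0, hex0] at this
      simp [h1, hy0]
      simpa using this
  refine ⟨key, ?_⟩
  intro r hr s hs
  by_cases hsr : s = r
  · rw [hsr]
  have k1 := key r hr
  rw [sum_split_sub B r s] at k1
  have k2 := key s hs
  rw [sum_split_sub B s r] at k2
  have m1 : ∑ A ∈ sub2 B r s, K A r * y (B \ A) = ∑ A ∈ sub2 B s r, K A s * y (B \ A) := by
    have e1 : ∀ r ∈ B, ∀ s ∈ B, ∑ A ∈ sub2 B r s, K A r * y (B \ A) =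
          ∑ A ∈ sub2 B r s, ∑ D ∈ sub1 (B \ A) s, K A r * (K D s * y ((B \ A) \ D)) := by
      intro r _ s hs
      apply Finset.sum_congr rfl
      intro A hA
      rw [mem_sub2] at hA
      rw [(ih (B \ A) (Finset.sdiff_ssubset hA.1 ⟨r, hA.2.1⟩)).1 s (by simp [hs, hA.2.2]),
          Finset.mul_sum]
    rw [e1 r hr s hs, e1 s hs r hr, sum_swap_sub B r s]
    apply Finset.sum_congr rfl
    intro D _
    apply Finset.sum_congr rfl
    intro A _
    rw [sdiff_right_comm]
    ring
  have hyy : y ∅ = 1 := hy0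
  have m2 : ∀ r s, r ∈ B → s ∈ B →
      ∑ A ∈ (sub1 B r).filter (fun A => s ∈ A), K A r * y (B \ A) =
      K B r + ∑ A ∈ ((sub1 B r).filter (fun A => s ∈ A)).erase B, K A r * y (B \ A) := by
    intro r s hr hs
    rw [← Finset.add_sum_erase _ _ (a := B) (by simp [mem_sub1, hr, hs])]
    simp [hy0]
  rw [m2 r s hr hs] at k1
  rw [m2 s r hs hr] at k2
  have m3 : ∑ A ∈ ((sub1 B r).filter (fun A => s ∈ A)).erase B, K A r * y (B \ A) =
      ∑ A ∈ ((sub1 B s).filter (fun A => r ∈ A)).erase B, K A s * y (B \ A) := by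
    have : (sub1 B r).filter (fun A => s ∈ A) = (sub1 B s).filter (fun A => r ∈ A) := by
      ext A; simp only [Finset.mem_filter, mem_sub1]; tauto
    rw [this]
    apply Finset.sum_congr rfl
    intro A hA
    simp only [Finset.mem_erase, Finset.mem_filter, mem_sub1] at hA
    rw [(ih A (Finset.ssubset_iff_subset_ne.2 ⟨hA.2.1.1, hA.1⟩)).2 r hA.2.2 s hA.2.1.2]
  rw [m1, m3] at k1
  rw [k1] at k2
  linear_combination k2
end Core
section Trees
variable {V R : Type*} [DecidableEq V] [Fintype V] [CommRing R]

def Rch (p : V → V) (i j : V) : Prop := ∃ k, p^[k] j = i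

theorem Rch.refl (p : V → V) (i : V) : Rch p i i := ⟨0, rfl⟩
theorem Rch.head {p : V → V} {i j : V} (h : Rch p i (p j)) : Rch p i j := by
  obtain ⟨k, hk⟩ := h
  exact ⟨k+1, by rwa [Function.iterate_succ_apply]⟩
theorem Rch.cases {p : V → V} {i j : V} (h : Rch p i j) : j = i ∨ Rch p i (p j) := by
  obtain ⟨k, hk⟩ := h
  cases k with
  | zero => left; exact hk
  | succ k => right; exact ⟨k, by rwa [Function.iterate_succ_apply] at hk⟩
theorem Rch.ind {p : V → V} {i : V} {P : V → Prop} (h0 : P i)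
    (hs : ∀ j, Rch p i (p j) → P (p j) → P j) {j : V} (h : Rch p i j) : P j := by
  obtain ⟨k, hk⟩ := h
  induction k generalizing j with
  | zero => have : j = i := hk
            rw [this]; exact h0
  | succ k ih =>
    rw [Function.iterate_succ_apply] at hk
    exact hs j ⟨k, hk⟩ (ih hk)
theorem Rch.trans {p : V → V} {i j k : V} (h : Rch p i j) (h' : Rch p j k) : Rch p i k :=
  Rch.ind (P := fun k => Rch p i k) h (fun _ _ h => h.head) h'
theorem Rch.closed {p : V → V} {S : Set V} (hS : ∀ j ∈ S, p j ∈ S) {i j : V} (h : Rch p i j)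
    (hj : j ∈ S) : i ∈ S :=
  Rch.ind (P := fun j => j ∈ S → i ∈ S) id (fun j _ h hj => h (hS j hj)) h hj
theorem Rch.transfer {p p' : V → V} {i : V} {S : Set V}
    (hS : ∀ j ∈ S, j ≠ i → (p j = p' j ∧ p j ∈ S) ∨ ¬ Rch p i j) {j : V} (hj : j ∈ S)
    (h : Rch p i j) : Rch p' i j := by
  refine Rch.ind (P := fun j => j ∈ S → Rch p' i j) (fun _ => Rch.refl _ _) ?_ h hj
  intro j h ih hj
  by_cases hji : j = i
  · rw [hji]; exact Rch.refl _ _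
  rcases hS j hj hji with ⟨h1, h2⟩ | h1
  · exact Rch.head (h1 ▸ ih h2)
  · exact absurd h.head h1
theorem Rch.fix {p : V → V} {i j : V} (hj : p j = j) (h : Rch p i j) : i = j := by
  have := Rch.closed (S := {j}) (by rintro x rfl; exact hj) h rfl
  exact this
theorem Rch.total {p : V → V} {i j s : V} (h : Rch p i s) (h' : Rch p j s) :
    Rch p i j ∨ Rch p j i := by
  refine Rch.ind (P := fun s => Rch p j s → Rch p i j ∨ Rch p j i) (fun h => Or.inr h) ?_ h h'
  intro s hs ih hj
  rcases hj.cases with rfl | h2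
  · left; exact hs.head
  · exact ih h2

open Classical in
noncomputable def Ds (p : V → V) (i : V) : Finset V := Finset.univ.filter (fun j => Rch p i j)

theorem mem_Ds {p : V → V} {i j : V} : j ∈ Ds p i ↔ Rch p i j := by simp [Ds]

def isT (B : Finset V) (r : V) (p : V → V) : Prop :=
  (∀ i, i ∉ B.erase r → p i = i) ∧ (∀ i ∈ B, p i ∈ B) ∧ ∀ i ∈ B, Rch p r i

open Classical in
noncomputable def Tr (B : Finset V) (r : V) : Finset (V → V) := Finset.univ.filter (isT B r)

theorem mem_Tr {B : Finset V} {r : V} {p : V → V} : p ∈ Tr B r ↔ isT B r p := by simp [Tr]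

noncomputable def WT (φ : V → V → Finset V → R) (B : Finset V) (r : V) : R :=
  ∑ p ∈ Tr B r, ∏ i ∈ B.erase r, φ i (p i) (Ds p i)

theorem WT_single (φ : V → V → Finset V → R) (r : V) : WT φ {r} r = 1 := by
  have : Tr {r} r = {id} := by
    ext p
    simp only [mem_Tr, isT, Finset.mem_singleton]
    constructor
    · rintro ⟨h, -⟩
      funext i
      exact h i (by simp)
    · rintro rfl
      simp [Rch.refl]
  simp [WT, this]

theorem WT_zero (φ : V → V → Finset V → R) (B : Finset V) (r i : V) (hi : i ∈ B) (hir : i ≠ r)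
    (h : ∀ j ∈ B, ∀ D, φ i j D = 0) : WT φ B r = 0 := by
  apply Finset.sum_eq_zero
  intro p hp
  rw [mem_Tr] at hp
  apply Finset.prod_eq_zero (i := i) (by simp [hi, hir])
  exact h _ (hp.2.1 i hi) _

theorem branch_exists {p : V → V} {r s : V} (hsr : s ≠ r) (h : Rch p r s) :
    ∃ v, v ≠ r ∧ p v = r ∧ Rch p v s := by
  refine Rch.ind (P := fun s => s ≠ r → ∃ v, v ≠ r ∧ p v = r ∧ Rch p v s)
    (fun h => absurd rfl h) ?_ h hsr
  intro j h ih hj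
  by_cases hp : p j = r
  · exact ⟨j, hj, hp, Rch.refl _ _⟩
  · obtain ⟨v, h1, h2, h3⟩ := ih hp
    exact ⟨v, h1, h2, h3.head⟩

theorem branch_aux {p : V → V} {r v i : V} (hr : p r = r) (hv : p v = r) (hir : i ≠ r)
    (h : Rch p i v) : i = v := by
  rcases h.cases with h | h
  · exact h.symm
  · rw [hv] at h
    exact absurd (h.fix hr) hir

theorem branch_unique {p : V → V} {r s v v' : V} (hr : p r = r)
    (h1 : v ≠ r) (h2 : p v = r) (h3 : Rch p v s)
    (h1' : v' ≠ r) (h2' : p v' = r) (h3' : Rch p v' s) : v = v' := by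
  rcases h3.total h3' with h | h
  · exact branch_aux hr h2' h1 h
  · exact (branch_aux hr h2 h1' h).symm

def glue (C : Finset V) (v r : V) (p₁ p₂ : V → V) : V → V :=
  fun i => if i = v then r else if i ∈ C then p₁ i else p₂ i

def restr (C : Finset V) (p : V → V) : V → V := fun i => if i ∈ C then p i else i

section glue
variable {B C : Finset V} {r v : V}

theorem glue_spec (hC : C ⊆ B) (hv : v ∈ C) (hr : r ∈ B) (hrC : r ∉ C)
    {p₁ p₂ : V → V} (h₁ : isT C v p₁) (h₂ : isT (B \ C) r p₂) :
    isT B r (glue C v r p₁ p₂) ∧ Ds (glue C v r p₁ p₂) v = C ∧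
    (∀ i ∈ C.erase v, Ds (glue C v r p₁ p₂) i = Ds p₁ i) ∧
    (∀ i ∈ (B \ C).erase r, Ds (glue C v r p₁ p₂) i = Ds p₂ i) := by
  set p := glue C v r p₁ p₂ with hp
  have pv : p v = r := by simp [hp, glue]
  have p1 : ∀ i ∈ C, i ≠ v → p i = p₁ i := by
    intro i hi hiv; simp [hp, glue, hi, hiv]
  have p2 : ∀ i, i ∉ C → p i = p₂ i := by
    intro i hi
    have : i ≠ v := fun h => hi (h ▸ hv)
    simp [hp, glue, hi, this]
  have pr : p r = r := by rw [p2 r hrC]; exact h₂.1 r (by simp)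
  have rv : ∀ j ∈ C, Rch p v j := by
    intro j hj
    refine Rch.transfer (p := p₁) (S := (C : Set V)) ?_ hj (h₁.2.2 j hj)
    intro j hj hjv
    exact Or.inl ⟨(p1 j hj hjv).symm, h₁.2.1 j hj⟩
  have clC : ∀ j ∈ ((C : Set V)ᶜ), p j ∈ ((C : Set V)ᶜ) := by
    intro j hj
    simp only [Set.mem_compl_iff, SetLike.mem_coe] at hj ⊢
    rw [p2 j hj]
    by_cases hjB : j ∈ B
    · exact (Finset.mem_sdiff.1 (h₂.2.1 j (by simp [hj, hjB]))).2
    · rwa [h₂.1 j (by simp [hjB])]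
  have out : ∀ j, j ∉ B → p j = j := by
    intro j hj
    rw [p2 j (fun h => hj (hC h))]
    exact h₂.1 j (by simp [hj])
  refine ⟨⟨?_, ?_, ?_⟩, ?_, ?_, ?_⟩
  · intro i hi
    simp only [Finset.mem_erase, not_and] at hi
    by_cases hir : i = r
    · rw [hir, pr]
    · exact out i (hi hir)
  · intro i hi
    by_cases hiv : i = v
    · rw [hiv, pv]; exact hr
    by_cases hiC : i ∈ C
    · rw [p1 i hiC hiv]; exact hC (h₁.2.1 i hiC)
    · rw [p2 i hiC]; exact (Finset.mem_sdiff.1 (h₂.2.1 i (by simp [hi, hiC]))).1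
  · intro j hj
    by_cases hjC : j ∈ C
    · refine Rch.trans (Rch.head ?_) (rv j hjC)
      rw [pv]; exact Rch.refl _ _
    · refine Rch.transfer (p := p₂) (S := ((B \ C : Finset V) : Set V)) ?_ (by simp [hj, hjC])
        (h₂.2.2 j (by simp [hj, hjC]))
      intro j hj hjr
      have hj' : j ∉ C := by simp at hj; exact hj.2
      exact Or.inl ⟨(p2 j hj').symm, h₂.2.1 j hj⟩
  · ext j
    rw [mem_Ds]
    refine ⟨fun h => ?_, rv j⟩
    by_contra hj
    exact (Rch.closed clC h (by simpa using hj)) hv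
  · intro i hi
    rw [Finset.mem_erase] at hi
    have hir : i ≠ r := fun h => hrC (h ▸ hi.2)
    ext j
    rw [mem_Ds, mem_Ds]
    by_cases hj : j ∈ C
    · constructor
      · refine Rch.transfer (S := (C : Set V)) ?_ hj
        intro j hj hji
        by_cases hjv : j = v
        · right
          intro h
          rw [hjv] at h
          exact hi.1 (branch_aux pr pv hir h)
        · left
          rw [p1 j hj hjv]
          exact ⟨rfl, h₁.2.1 j hj⟩
      · refine Rch.transfer (S := (C : Set V)) ?_ hj
        intro j hj hji
        by_cases hjv : j = v
        · right
          intro h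
          rw [hjv] at h
          exact hi.1 (h.fix (h₁.1 v (by simp)))
        · left
          rw [p1 j hj hjv]
          exact ⟨rfl, h₁.2.1 j hj⟩
    · constructor
      · intro h
        exact absurd hi.2 (Rch.closed clC h (by simpa using hj))
      · intro h
        have := h.fix (h₁.1 j (by simp [hj]))
        exact absurd (this ▸ hi.2) hj
  · intro i hi
    rw [Finset.mem_erase, Finset.mem_sdiff] at hi
    ext j
    rw [mem_Ds, mem_Ds]
    by_cases hj : j ∈ C
    · constructor
      · intro h
        have h' := Rch.total h (rv j hj)
        rcases h' with h' | h'
        · have := branch_aux pr pv hi.1 h'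
          exact absurd (this ▸ hv) hi.2.2
        · exact absurd hv (Rch.closed clC h' (by simpa using hi.2.2))
      · intro h
        have := h.fix (h₂.1 j (by simp [hj]))
        exact absurd (this ▸ hj) hi.2.2
    · constructor
      · refine Rch.transfer (S := (C : Set V)ᶜ) ?_ (by simpa using hj)
        intro j hj _
        exact Or.inl ⟨p2 j (by simpa using hj), clC j hj⟩
      · refine Rch.transfer (S := (C : Set V)ᶜ) ?_ (by simpa using hj)
        intro j hj _
        exact Or.inl ⟨(p2 j (by simpa using hj)).symm, p2 j (by simpa using hj) ▸ clC j hj⟩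

theorem restr_spec (hv : v ∈ C)
    {p : V → V} (h : isT B r p) (hD : Ds p v = C) :
    isT C v (restr (C.erase v) p) ∧ isT (B \ C) r (restr (B \ C) p) := by
  have hCi : ∀ j, j ∈ C ↔ Rch p v j := by intro j; rw [← hD, mem_Ds]
  have c1 : ∀ j ∈ C, j ≠ v → p j ∈ C := by
    intro j hj hjv
    rw [hCi] at hj ⊢
    exact hj.cases.resolve_left hjv
  have c2 : ∀ j, j ∉ C → p j ∉ C := by
    intro j hj
    rw [hCi] at hj ⊢
    exact fun h => hj h.head
  have pr : p r = r := h.1 r (by simp)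
  refine ⟨⟨?_, ?_, ?_⟩, ?_, ?_, ?_⟩
  · intro i hi
    simp only [restr, if_neg hi]
  · intro i hi
    by_cases hiv : i = v
    · simp [restr, hiv, hv]
    · simp [restr, hiv, hi, c1]
  · intro j hj
    refine Rch.transfer (S := (C : Set V)) ?_ hj ((hCi j).1 hj)
    intro j hj hjv
    have hj' : j ∈ C := hj
    left
    exact ⟨by simp [restr, hj', hjv], c1 j hj hjv⟩
  · intro i hi
    simp only [restr]
    split_ifs with h'
    · have : i = r := by
        by_contra hne
        exact hi (by simp [hne, Finset.mem_sdiff.1 h'])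
      rw [this, pr]
    · rfl
  · intro i hi
    simp only [restr, if_pos hi]
    rw [Finset.mem_sdiff] at hi ⊢
    exact ⟨h.2.1 i hi.1, c2 i hi.2⟩
  · intro j hj
    refine Rch.transfer (p := p) (S := ((B \ C : Finset V) : Set V)) ?_ hj
      (h.2.2 j (Finset.mem_sdiff.1 hj).1)
    intro j hj _
    left
    have hj' : j ∈ B \ C := hj
    refine ⟨by simp only [restr, if_pos hj'], ?_⟩
    rw [Finset.mem_sdiff] at hj'
    simp [h.2.1 j hj'.1, c2 j hj'.2]

open Classical in
theorem fiber_sum (hC : C ⊆ B) (hv : v ∈ C) (hr : r ∈ B) (hrC : r ∉ C)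
    (φ : V → V → Finset V → R) :
    ∑ p ∈ (Tr B r).filter (fun p => p v = r ∧ Ds p v = C), ∏ i ∈ B.erase r, φ i (p i) (Ds p i)
      = φ v r C * WT φ C v * WT φ (B \ C) r := by
  have hvr : v ≠ r := fun h => hrC (h ▸ hv)
  rw [WT, WT, mul_assoc, Finset.sum_mul_sum, ← Finset.sum_product', Finset.mul_sum]
  symm
  refine Finset.sum_nbij' (fun x => glue C v r x.1 x.2)
    (fun p => (restr (C.erase v) p, restr (B \ C) p)) ?_ ?_ ?_ ?_ ?_
  · rintro ⟨p₁, p₂⟩ hx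
    simp only [Finset.mem_product, mem_Tr] at hx
    have := glue_spec hC hv hr hrC hx.1 hx.2
    simp only [Finset.mem_filter, mem_Tr]
    exact ⟨this.1, by simp [glue], this.2.1⟩
  · intro p hp
    simp only [Finset.mem_filter, mem_Tr] at hp
    simp only [Finset.mem_product, mem_Tr]
    exact restr_spec hv hp.1 hp.2.2
  · rintro ⟨p₁, p₂⟩ hx
    simp only [Finset.mem_product, mem_Tr] at hx
    obtain ⟨h₁, h₂⟩ := hx
    simp only [Prod.mk.injEq]
    constructor
    · funext i
      simp only [restr, glue]
      by_cases hi : i ∈ C.erase v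
      · have := Finset.mem_erase.1 hi
        simp [this]
      · rw [if_neg hi, h₁.1 i hi]
    · funext i
      simp only [restr, glue]
      by_cases hi : i ∈ B \ C
      · rw [if_pos hi]
        rw [Finset.mem_sdiff] at hi
        have : i ≠ v := fun h => hi.2 (h ▸ hv)
        simp [this, hi]
      · rw [if_neg hi, h₂.1 i (fun h => hi (Finset.mem_of_mem_erase h))]
  · intro p hp
    simp only [Finset.mem_filter, mem_Tr] at hp
    obtain ⟨h, hpv, -⟩ := hp
    funext i
    simp only [restr, glue]
    by_cases hiv : i = v
    · simp [hiv, hpv]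
    by_cases hiC : i ∈ C
    · simp [hiv, hiC]
    by_cases hiB : i ∈ B
    · simp [hiv, hiC, hiB]
    · simp [hiv, hiC, hiB, h.1 i (fun h => hiB (Finset.mem_of_mem_erase h))]
  · rintro ⟨p₁, p₂⟩ hx
    simp only [Finset.mem_product, mem_Tr] at hx
    obtain ⟨h₁, h₂⟩ := hx
    obtain ⟨g1, g2, g3, g4⟩ := glue_spec hC hv hr hrC h₁ h₂
    have hB : B.erase r = insert v (C.erase v ∪ (B \ C).erase r) := by
      ext x
      simp only [Finset.mem_erase, Finset.mem_insert, Finset.mem_union, Finset.mem_sdiff]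
      by_cases hxv : x = v
      · subst hxv; simp [hvr, hC hv]
      by_cases hxC : x ∈ C
      · have : x ≠ r := fun h => hrC (h ▸ hxC)
        simp [hxv, hxC, hC hxC, this]
      · simp [hxv, hxC]
    rw [hB, Finset.prod_insert (by simp [hv]), Finset.prod_union]
    · congr 1
      · rw [g2]; simp [glue]
      congr 1
      · apply Finset.prod_congr rfl
        intro i hi
        rw [g3 i hi]
        rw [Finset.mem_erase] at hi
        simp [glue, hi]
      · apply Finset.prod_congr rfl
        intro i hi
        rw [g4 i hi]
        rw [Finset.mem_erase, Finset.mem_sdiff] at hi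
        have : i ≠ v := fun h => hi.2.2 (h ▸ hv)
        simp [glue, hi, this]
    · rw [Finset.disjoint_left]
      intro x hx hx'
      simp only [Finset.mem_erase, Finset.mem_sdiff] at hx hx'
      exact hx'.2.2 hx.2
end glue

open Classical in
theorem WT_rec (φ : V → V → Finset V → R) (B : Finset V) (r s : V) (hr : r ∈ B) (hs : s ∈ B)
    (hsr : s ≠ r) :
    WT φ B r = ∑ C ∈ sub2 B s r, (∑ v ∈ C, φ v r C * WT φ C v) * WT φ (B \ C) r := by
  have e : ∀ C ∈ sub2 B s r, (∑ v ∈ C, φ v r C * WT φ C v) * WT φ (B \ C) r =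
      ∑ v ∈ C, ∑ p ∈ (Tr B r).filter (fun p => p v = r ∧ Ds p v = C),
        ∏ i ∈ B.erase r, φ i (p i) (Ds p i) := by
    intro C hC
    rw [mem_sub2] at hC
    rw [Finset.sum_mul]
    apply Finset.sum_congr rfl
    intro v hv
    rw [fiber_sum hC.1 hv hr hC.2.2]
  rw [Finset.sum_congr rfl e, Finset.sum_sigma', Finset.sum_sigma', WT]
  symm
  refine Finset.sum_bij (fun x _ => x.2) ?_ ?_ ?_ ?_
  · rintro ⟨⟨C, v⟩, p⟩ h
    simp only [Finset.mem_sigma, Finset.mem_filter] at h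
    exact h.2.1
  · rintro ⟨⟨C, v⟩, p⟩ h ⟨⟨C', v'⟩, p'⟩ h' hpp
    simp only [Finset.mem_sigma, Finset.mem_filter, mem_sub2, mem_Tr] at h h' hpp
    subst hpp
    obtain ⟨⟨⟨a1, a2, a3⟩, a4⟩, a5, a6, a7⟩ := h
    obtain ⟨⟨⟨b1, b2, b3⟩, b4⟩, b5, b6, b7⟩ := h'
    have hvv : v = v' := by
      apply branch_unique (p := p) (r := r) (s := s) (a5.1 r (by simp))
      · exact fun h => a3 (h ▸ a4)
      · exact a6
      · rw [← mem_Ds, a7]; exact a2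
      · exact fun h => b3 (h ▸ b4)
      · exact b6
      · rw [← mem_Ds, b7]; exact b2
    subst hvv
    rw [a7] at b7
    subst b7
    rfl
  · intro p hp
    have hp' := hp
    rw [mem_Tr] at hp'
    obtain ⟨v, h1, h2, h3⟩ := branch_exists hsr (hp'.2.2 s hs)
    have pr := hp'.1 r (by simp)
    refine ⟨⟨⟨Ds p v, v⟩, p⟩, ?_, rfl⟩
    simp only [Finset.mem_sigma, Finset.mem_filter, mem_sub2, mem_Ds]
    refine ⟨⟨⟨?_, h3, fun h => h1 (h.fix pr)⟩, Rch.refl _ _⟩, hp, h2, trivial⟩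
    intro j hj
    rw [mem_Ds] at hj
    by_contra hjB
    have := hj.fix (hp'.1 j (fun h => hjB (Finset.mem_of_mem_erase h)))
    subst this
    have := h3.closed (S := (B : Set V)) hp'.2.1 hs
    exact hjB this
  · intros; rfl
end Trees
section Main
variable {n : ℕ} (G : SimpleGraph (Fin (n+1))) (a : Fin (n+1) → ℕ)

open Classical in
noncomputable def phiA (i p : Fin (n+1)) (D : Finset (Fin (n+1))) : Polynomial ℤ :=
  if G.Adj i p then qnat (a (max i p)) * ∏ j ∈ D.filter (fun j => j < i), X ^ a (max p j) else 0

open Classical in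
noncomputable def phiF (i p : Fin (n+1)) (D : Finset (Fin (n+1))) : Polynomial ℤ :=
  if p < i ∧ G.Adj i p then qnat (∑ j ∈ D, a j) else 0

open Classical in
noncomputable def gA (i j : Fin (n+1)) : Polynomial ℤ :=
  if G.Adj i j then X ^ a (max i j) else 1

theorem gA_symm (i j : Fin (n+1)) : gA G a i j = gA G a j i := by
  rw [gA, gA, max_comm i j]
  by_cases h : G.Adj i j
  · rw [if_pos h, if_pos h.symm]
  · rw [if_neg h, if_neg (fun h' => h h'.symm)]

noncomputable def exA (r : Fin (n+1)) (D : Finset (Fin (n+1))) : Polynomial ℤ :=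
  ∏ v ∈ D, gA G a r v

noncomputable def yA (B : Finset (Fin (n+1))) : Polynomial ℤ :=
  ∏ i ∈ B, ∏ j ∈ B, if j < i then gA G a i j else 1

theorem yA_insert (r : Fin (n+1)) (B : Finset (Fin (n+1))) (h : r ∉ B) :
    yA G a (insert r B) = yA G a B * exA G a r B := by
  have e : ∀ i, ∏ j ∈ insert r B, (if j < i then gA G a i j else 1) =
      (if r < i then gA G a i r else 1) * ∏ j ∈ B, (if j < i then gA G a i j else 1) :=
    fun i => Finset.prod_insert h
  simp only [yA, e, Finset.prod_insert h, lt_irrefl, if_false, one_mul, Finset.prod_mul_distrib]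
  rw [← mul_assoc, ← Finset.prod_mul_distrib, mul_comm]
  congr 1
  apply Finset.prod_congr rfl
  intro i hi
  have hne : i ≠ r := fun h' => h (h' ▸ hi)
  rcases lt_or_gt_of_ne hne with h1 | h1
  · simp [h1, h1.not_gt]
  · simp [h1, h1.not_gt, gA_symm G a i r]

theorem X1_mul_qnat (b : ℕ) : (X - 1 : Polynomial ℤ) * qnat b = X ^ b - 1 := by
  rw [qnat, mul_comm, geom_sum_mul]

theorem X1_ne : (X - 1 : Polynomial ℤ) ≠ 0 := by
  simpa using Polynomial.X_sub_C_ne_zero (1 : ℤ)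

variable {G}

theorem psi_sum (hG : IsThreshold n G) (r : Fin (n+1)) (D : Finset (Fin (n+1))) (hr : r ∉ D) :
    (X - 1 : Polynomial ℤ) * ∑ v ∈ D, phiA G a v r D = exA G a r D - 1 := by
  induction D using Finset.induction_on_max with
  | empty => simp [exA]
  | insert m D hm ih =>
    have hmD : m ∉ D := fun h => lt_irrefl _ (hm m h)
    rw [Finset.mem_insert, not_or] at hr
    have e1 : ∀ v ∈ D, phiA G a v r (insert m D) = phiA G a v r D := by
      intro v hv
      rw [phiA, phiA, Finset.filter_insert, if_neg (hm v hv).not_gt]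
    have e2 : (insert m D).filter (fun j => j < m) = D := by
      rw [Finset.filter_insert, if_neg (lt_irrefl _), Finset.filter_true_of_mem hm]
    rw [Finset.sum_insert hmD, Finset.sum_congr rfl e1, mul_add, ih hr.2, exA, exA,
      Finset.prod_insert hmD, phiA, e2]
    by_cases hadj : G.Adj m r
    · rw [if_pos hadj, gA, if_pos hadj.symm, max_comm r m, ← mul_assoc, X1_mul_qnat]
      have : ∏ j ∈ D, (X : Polynomial ℤ) ^ a (max r j) = ∏ v ∈ D, gA G a r v := by
        apply Finset.prod_congr rfl
        intro j hj
        have hjr : j ≠ r := fun h => hr.2 (h ▸ hj)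
        have : G.Adj r j := by
          rcases lt_or_gt_of_ne hr.1 with h | h
          · exact (hG m r j r h hadj (hm j hj).le le_rfl hjr).symm
          · exact hG r m r j h hadj.symm le_rfl (hm j hj).le hjr.symm
        rw [gA, if_pos this]
      rw [this]
      ring
    · rw [if_neg hadj, gA, if_neg (fun h => hadj h.symm)]
      ring

theorem WA_indep (hG : IsThreshold n G) (B : Finset (Fin (n+1))) (r s : Fin (n+1))
    (hr : r ∈ B) (hs : s ∈ B) : WT (phiA G a) B r = WT (phiA G a) B s := by
  have := (core (fun B r => (X - 1 : Polynomial ℤ) ^ (B.card - 1) * WT (phiA G a) B r)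
    (yA G a) (exA G a) (fun v r D => (X - 1) * phiA G a v r D)
    (by intro r; simp [WT_single]) (by simp [yA]) (yA_insert G a) (by simp [exA])
    (by intro r D E h; simp only [exA]; exact Finset.prod_union h)
    (by intro r D h; rw [← Finset.mul_sum]; exact psi_sum a hG r D h)
    (by
      intro B r s hr hs hsr
      rw [WT_rec (phiA G a) B r s hr hs hsr, Finset.mul_sum]
      apply Finset.sum_congr rfl
      intro D hD
      rw [mem_sub2] at hD
      have h1 : 0 < D.card := Finset.card_pos.2 ⟨s, hD.2.1⟩
      have h2 : 0 < (B \ D).card := Finset.card_pos.2 ⟨r, by simp [hr, hD.2.2]⟩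
      have h3 := Finset.card_sdiff_add_card_eq_card hD.1
      have h4 : B.card - 1 = 1 + (D.card - 1) + ((B \ D).card - 1) := by omega
      rw [h4, pow_add, pow_add, pow_one]
      have : ∑ v ∈ D, (X - 1) * phiA G a v r D *
          ((X - 1) ^ (D.card - 1) * WT (phiA G a) D v) =
          (X - 1) * (X - 1) ^ (D.card - 1) * ∑ v ∈ D, phiA G a v r D * WT (phiA G a) D v := by
        rw [Finset.mul_sum]
        apply Finset.sum_congr rfl
        intros; ring
      rw [this]
      ring) B).2 r hr s hs
  exact mul_left_cancel₀ (pow_ne_zero _ X1_ne) this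

theorem WF_eq_WA (hG : IsThreshold n G) (B : Finset (Fin (n+1))) :
    ∀ m ∈ B, (∀ x ∈ B, m ≤ x) → WT (phiF G a) B m = WT (phiA G a) B m := by
  induction B using Finset.strongInduction with
  | H B ih =>
  intro m hm hmin
  by_cases hs : ∃ s ∈ B, s ≠ m
  · obtain ⟨s, hs, hsm⟩ := hs
    rw [WT_rec _ B m s hm hs hsm, WT_rec _ B m s hm hs hsm]
    apply Finset.sum_congr rfl
    intro C hC
    rw [mem_sub2] at hC
    obtain ⟨hCB, hsC, hmC⟩ := hC
    have hne : C.Nonempty := ⟨s, hsC⟩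
    rw [ih (B \ C) (Finset.sdiff_ssubset hCB hne) m (by simp [hm, hmC])
      (fun x hx => hmin x (Finset.mem_sdiff.1 hx).1)]
    congr 1
    have hCss : C ⊂ B := by
      refine Finset.ssubset_iff_subset_ne.2 ⟨hCB, ?_⟩
      rintro rfl
      exact hmC hm
    set c := C.min' hne with hc
    have hcC : c ∈ C := C.min'_mem hne
    have hcmin : ∀ x ∈ C, c ≤ x := fun x hx => C.min'_le x hx
    set M := C.max' hne with hM
    have hMC : M ∈ C := C.max'_mem hne
    have hMmax : ∀ x ∈ C, x ≤ M := fun x hx => C.le_max' x hx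
    have hmlt : ∀ x ∈ C, m < x := fun x hx =>
      lt_of_le_of_ne (hmin x (hCB hx)) (fun h => hmC (h ▸ hx))
    have eF : ∑ v ∈ C, phiF G a v m C * WT (phiF G a) C v = phiF G a c m C * WT (phiA G a) C c := by
      rw [Finset.sum_eq_single_of_mem c hcC, ih C hCss c hcC hcmin]
      intro v hv hvc
      rw [WT_zero (phiF G a) C v c hcC hvc.symm, mul_zero]
      intro j hj D
      rw [phiF, if_neg]
      exact fun h => absurd (hcmin j hj) (not_le.2 h.1)
    have eA : ∑ v ∈ C, phiA G a v m C * WT (phiA G a) C v =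
        (∑ v ∈ C, phiA G a v m C) * WT (phiA G a) C c := by
      rw [Finset.sum_mul]
      apply Finset.sum_congr rfl
      intro v hv
      rw [WA_indep a hG C v c hv hcC]
    rw [eF, eA]
    by_cases hadj : G.Adj M m
    · have hall : ∀ v ∈ C, G.Adj v m := fun v hv =>
        hG M m v m (hmlt M hMC) hadj (hMmax v hv) le_rfl (hmlt v hv).ne'
      congr 1
      apply mul_left_cancel₀ X1_ne
      rw [psi_sum a hG m C hmC, phiF, if_pos ⟨hmlt c hcC, hall c hcC⟩, X1_mul_qnat, exA,
        ← Finset.prod_pow_eq_pow_sum]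
      congr 1
      apply Finset.prod_congr rfl
      intro v hv
      rw [gA, if_pos (hall v hv).symm, max_eq_right (hmlt v hv).le]
    · by_cases hcM : c = M
      · have hall : ∀ v ∈ C, ¬ G.Adj v m := by
          intro v hv
          have : v = M := le_antisymm (hMmax v hv) (hcM ▸ hcmin v hv)
          rwa [this]
        rw [phiF, if_neg (fun h => hall c hcC h.2), Finset.sum_eq_zero]
        intro v hv
        rw [phiA, if_neg (hall v hv)]
      · rw [WT_zero (phiA G a) C c M hMC (Ne.symm hcM), mul_zero, mul_zero]
        intro j hj D
        rw [phiA, if_neg]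
        intro h
        exact hadj (hG M j M m (lt_of_le_of_ne (hMmax j hj) h.ne') h le_rfl (hmlt j hj).le
          (hmlt M hMC).ne')
  · push Not at hs
    have : B = {m} := by
      ext x
      simp only [Finset.mem_singleton]
      exact ⟨hs x, fun h => h ▸ hm⟩
    rw [this, WT_single, WT_single]

theorem Ds_zero_notMem {p : Fin (n+1) → Fin (n+1)} (hp : p 0 = 0) {i : Fin (n+1)} (hi : i ≠ 0)
    : (0 : Fin (n+1)) ∉ Ds p i := by
  rw [mem_Ds]
  exact fun h => hi (h.fix hp)

theorem trees_eq :
    ∑ᶠ p ∈ {p | IsSpanTree n G p},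
        (∏ i ∈ Finset.univ.erase (0 : Fin (n+1)), qnat (a (max i (p i)))) *
          ∏ᶠ pr ∈ invSet n p, (X : Polynomial ℤ) ^ a (max (p pr.1) pr.2)
      = WT (phiA G a) Finset.univ 0 := by
  classical
  have hset : {p | IsSpanTree n G p} =
      (((Tr Finset.univ (0 : Fin (n+1))).filter
        (fun p => ∀ i ∈ Finset.univ.erase (0 : Fin (n+1)), G.Adj i (p i)) :
        Finset (Fin (n+1) → Fin (n+1))) : Set _) := by
    ext p
    simp only [Set.mem_ofPred_eq, Finset.coe_filter, mem_Tr, isT, IsSpanTree, Rch,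
      Finset.mem_erase, Finset.mem_univ, and_true, not_not, forall_eq, forall_const, true_and]
    tauto
  rw [hset, finsum_mem_coe_finset, WT, Finset.sum_filter]
  apply Finset.sum_congr rfl
  intro p hp
  split_ifs with h
  · have e : ∏ i ∈ Finset.univ.erase (0 : Fin (n+1)), phiA G a i (p i) (Ds p i) =
        ∏ i ∈ Finset.univ.erase (0 : Fin (n+1)), (qnat (a (max i (p i))) *
          ∏ j ∈ (Ds p i).filter (fun j => j < i), X ^ a (max (p i) j)) := by
      apply Finset.prod_congr rfl
      intro i hi
      rw [phiA, if_pos (h i hi)]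
    rw [e, Finset.prod_mul_distrib]
    congr 1
    have hinv : invSet n p = ((Finset.univ.filter
        (fun pr : Fin (n+1) × Fin (n+1) => pr.2 < pr.1 ∧ pr.1 ≠ 0 ∧ Rch p pr.1 pr.2) :
        Finset (Fin (n+1) × Fin (n+1))) : Set _) := by
      ext pr
      rw [Finset.mem_coe, Finset.mem_filter]
      exact ⟨fun h => ⟨Finset.mem_univ _, h⟩, fun h => h.2⟩
    rw [hinv, finprod_mem_coe_finset, Finset.prod_sigma']
    apply Finset.prod_nbij' (fun pr => ⟨pr.1, pr.2⟩) (fun x => (x.1, x.2))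
    · rintro ⟨i, j⟩ h
      simp only [Finset.mem_filter, Finset.mem_univ, true_and] at h
      simp [mem_Ds, h]
    · rintro ⟨i, j⟩ h
      simp only [Finset.mem_sigma, Finset.mem_filter, Finset.mem_erase, Finset.mem_univ,
        mem_Ds] at h
      simp [h]
    · rintro ⟨i, j⟩ h; rfl
    · rintro ⟨i, j⟩ h; rfl
    · rintro ⟨i, j⟩ h; rfl
  · push Not at h
    obtain ⟨i, hi, hadj⟩ := h
    symm
    apply Finset.prod_eq_zero hi
    rw [phiA, if_neg hadj]

def goodP (G : SimpleGraph (Fin (n+1))) (p : Fin (n+1) → Fin (n+1)) : Prop :=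
  p 0 = 0 ∧ ∀ i, i ≠ 0 → p i < i ∧ G.Adj i (p i)

noncomputable def fl (p : Fin (n+1) → Fin (n+1)) (i j : Fin (n+1)) : ℕ :=
  if i ≠ 0 ∧ p i = j then ∑ k ∈ Ds p i, a k else 0

theorem goodP.reach {p : Fin (n+1) → Fin (n+1)} (h : goodP G p) (i : Fin (n+1)) : Rch p 0 i := by
  induction i using WellFoundedLT.induction with
  | ind i ih =>
    by_cases hi : i = 0
    · rw [hi]; exact Rch.refl _ _
    · exact (ih (p i) (h.2 i hi).1).head

theorem goodP.le {p : Fin (n+1) → Fin (n+1)} (h : goodP G p) {i j : Fin (n+1)} (hr : Rch p i j) :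
    i ≤ j := by
  refine Rch.closed (S := {x | x ≤ j}) ?_ hr (le_refl j)
  intro x hx
  by_cases hx0 : x = 0
  · rw [hx0, h.1]; exact Fin.zero_le _
  · exact (h.2 x hx0).1.le.trans hx

theorem goodP.noRch {p : Fin (n+1) → Fin (n+1)} (h : goodP G p) {j : Fin (n+1)} (hj : j ≠ 0) :
    ¬ Rch p j (p j) := fun hr => absurd (h.le hr) (not_le.2 (h.2 j hj).1)

theorem Ds_sum {p : Fin (n+1) → Fin (n+1)} (h : goodP G p) {i : Fin (n+1)} (hi : i ≠ 0) :
    ∑ k ∈ Ds p i, a k = a i + ∑ j, fl a p j i := by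
  classical
  have h0 : ∀ j, p j = i → j ≠ 0 := by
    rintro j hj rfl
    exact hi (hj ▸ h.1)
  have e : Ds p i = insert i ((Finset.univ.filter (fun j => p j = i)).biUnion (Ds p)) := by
    ext k
    simp only [mem_Ds, Finset.mem_insert, Finset.mem_biUnion, Finset.mem_filter, Finset.mem_univ,
      true_and]
    constructor
    · intro hk
      by_cases hki : k = i
      · exact Or.inl hki
      · obtain ⟨v, -, h2, h3⟩ := branch_exists hki hk
        exact Or.inr ⟨v, h2, h3⟩
    · rintro (rfl | ⟨v, hv, hk⟩)
      · exact Rch.refl _ _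
      · refine Rch.trans (Rch.head ?_) hk
        rw [hv]; exact Rch.refl _ _
  rw [e, Finset.sum_insert, Finset.sum_biUnion, Finset.sum_filter]
  · congr 1
    apply Finset.sum_congr rfl
    intro j _
    rw [fl]
    by_cases hj : p j = i
    · simp [hj, h0 j hj]
    · simp [hj]
  · intro j hj j' hj' hne
    simp only [Finset.coe_filter, Finset.mem_univ, true_and, Set.mem_ofPred_eq] at hj hj'
    rw [Function.onFun, Finset.disjoint_left]
    intro k hk hk'
    rw [mem_Ds] at hk hk'
    rcases hk.total hk' with hr | hr
    · rcases hr.cases with h1 | h1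
      · exact hne h1.symm
      · rw [hj', ← hj] at h1
        exact h.noRch (h0 j hj) h1
    · rcases hr.cases with h1 | h1
      · exact hne h1
      · rw [hj, ← hj'] at h1
        exact h.noRch (h0 j' hj') h1
  · simp only [Finset.mem_biUnion, Finset.mem_filter, Finset.mem_univ, true_and, mem_Ds]
    rintro ⟨j, hj, hr⟩
    rw [← hj] at hr
    exact h.noRch (h0 j hj) hr

variable {a}

theorem Ds_pos (ha : ∀ i : Fin (n+1), i ≠ 0 → 0 < a i) {p : Fin (n+1) → Fin (n+1)}
    {i : Fin (n+1)} (hi : i ≠ 0) : 0 < ∑ k ∈ Ds p i, a k :=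
  (ha i hi).trans_le (Finset.single_le_sum (f := a) (fun _ _ => Nat.zero_le _)
    (mem_Ds.2 (Rch.refl _ _)))

theorem fl_pos (ha : ∀ i : Fin (n+1), i ≠ 0 → 0 < a i) {p : Fin (n+1) → Fin (n+1)}
    {i j : Fin (n+1)} : 0 < fl a p i j ↔ i ≠ 0 ∧ p i = j := by
  rw [fl]
  split_ifs with h
  · exact ⟨fun _ => h, fun _ => Ds_pos ha h.1⟩
  · simp [h]

theorem fl_flow {p : Fin (n+1) → Fin (n+1)} (h : goodP G p) : IsFlow n G a (fl a p) := by
  constructor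
  · intro i j hij
    rw [fl] at hij
    have h1 : i ≠ 0 ∧ p i = j := by
      by_contra hh
      exact hij (if_neg hh)
    rw [← h1.2]
    exact h.2 i h1.1
  · intro i hi
    rw [← Ds_sum a h hi]
    simp [fl, hi]

theorem card_graph (p : Fin (n+1) → Fin (n+1)) :
    ((Finset.univ.erase (0 : Fin (n+1))).image (fun i => (i, p i))).card = n := by
  rw [Finset.card_image_of_injective]
  · simp
  · intro i j hij
    exact (Prod.mk.inj hij).1

theorem flow_unique {p : Fin (n+1) → Fin (n+1)} {f g : Fin (n+1) → Fin (n+1) → ℕ}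
    (hf : IsFlow n G a f) (hg : IsFlow n G a g)
    (hfp : ∀ i j, f i j ≠ 0 → i ≠ 0 ∧ p i = j) (hgp : ∀ i j, g i j ≠ 0 → i ≠ 0 ∧ p i = j) :
    f = g := by
  funext i
  induction i using WellFoundedGT.induction with
  | ind i ih =>
  have z : ∀ (f : Fin (n+1) → Fin (n+1) → ℕ), (∀ i j, f i j ≠ 0 → i ≠ 0 ∧ p i = j) →
      ∀ j, ¬ (i ≠ 0 ∧ p i = j) → f i j = 0 := by
    intro f hf j h
    by_contra hne
    exact h (hf i j hne)
  funext j
  by_cases hij : i ≠ 0 ∧ p i = j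
  · obtain ⟨hi, rfl⟩ := hij
    have s : ∀ (f : Fin (n+1) → Fin (n+1) → ℕ), (∀ i j, f i j ≠ 0 → i ≠ 0 ∧ p i = j) →
        ∑ j, f i j = f i (p i) := by
      intro f hf
      apply Finset.sum_eq_single_of_mem _ (Finset.mem_univ _)
      intro j _ hj
      exact z f hf j (fun h => hj h.2.symm)
    rw [← s f hfp, ← s g hgp, hf.2 i hi, hg.2 i hi]
    congr 1
    apply Finset.sum_congr rfl
    intro k _
    by_cases hk : i < k
    · rw [ih k hk]
    · have h1 : f k i = 0 := by
        by_contra h; exact hk (hf.1 k i h).1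
      have h2 : g k i = 0 := by
        by_contra h; exact hk (hg.1 k i h).1
      rw [h1, h2]
  · rw [z f hfp j hij, z g hgp j hij]

theorem flows_bij (ha : ∀ i : Fin (n+1), i ≠ 0 → 0 < a i) :
    Set.BijOn (fl a) {p | goodP G p} {f | IsFlow n G a f ∧ posCount n f = n} := by
  refine ⟨?_, ?_, ?_⟩
  · intro p hp
    refine ⟨fl_flow hp, ?_⟩
    rw [posCount]
    conv_rhs => rw [← card_graph p]
    congr 1
    ext ⟨i, j⟩
    simp only [Finset.mem_filter, Finset.mem_univ, true_and, fl_pos ha, Finset.mem_image,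
      Finset.mem_erase, Prod.mk.injEq, and_true]
    constructor
    · rintro ⟨h1, h2⟩
      exact ⟨i, h1, rfl, h2⟩
    · rintro ⟨i', h1, rfl, h2⟩
      exact ⟨h1, h2⟩
  · intro p hp p' hp' hpp
    funext i
    by_cases hi : i = 0
    · rw [hi, hp.1, hp'.1]
    · have : 0 < fl a p i (p i) := (fl_pos ha).2 ⟨hi, rfl⟩
      rw [hpp, fl_pos ha] at this
      exact this.2.symm
  · rintro f ⟨hf, hcard⟩
    have hex : ∀ i : Fin (n+1), ∃ j, (i ≠ 0 → 0 < f i j) ∧ (i = 0 → j = 0) := by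
      intro i
      by_cases hi : i = 0
      · exact ⟨0, fun h => absurd hi h, fun _ => rfl⟩
      · have h1 : 0 < ∑ j, f i j := by
          rw [hf.2 i hi]
          exact Nat.add_pos_left (ha i hi) _
        obtain ⟨j, -, hj⟩ := Finset.exists_ne_zero_of_sum_ne_zero h1.ne'
        exact ⟨j, fun _ => Nat.pos_of_ne_zero hj, fun h => absurd h hi⟩
    choose p hp hp0 using hex
    have hgood : goodP G p := ⟨hp0 0 rfl, fun i hi => hf.1 i (p i) (hp i hi).ne'⟩
    have hsub : (Finset.univ.erase (0 : Fin (n+1))).image (fun i => (i, p i)) ⊆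
        Finset.univ.filter (fun pr : Fin (n+1) × Fin (n+1) => 0 < f pr.1 pr.2) := by
      intro x hx
      simp only [Finset.mem_image, Finset.mem_erase, Finset.mem_univ, and_true] at hx
      obtain ⟨i, hi, rfl⟩ := hx
      simp [hp i hi]
    have heq := Finset.eq_of_subset_of_card_le hsub (by
      rw [card_graph]; exact hcard.le)
    refine ⟨p, hgood, ?_⟩
    apply flow_unique (p := p) (fl_flow hgood) hf
    · intro i j h
      exact (fl_pos ha).1 (Nat.pos_of_ne_zero h)
    · intro i j h
      have : (i, j) ∈ Finset.univ.filter
          (fun pr : Fin (n+1) × Fin (n+1) => 0 < f pr.1 pr.2) := by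
        simp [Nat.pos_of_ne_zero h]
      rw [← heq] at this
      simp only [Finset.mem_image, Finset.mem_erase, Finset.mem_univ, and_true,
        Prod.mk.injEq] at this
      obtain ⟨i', h1, rfl, h2⟩ := this
      exact ⟨h1, h2⟩

theorem flows_eq (ha : ∀ i : Fin (n+1), i ≠ 0 → 0 < a i) :
    Ehr1 n G a = WT (phiF G a) Finset.univ 0 := by
  classical
  rw [Ehr1, ← finsum_mem_eq_of_bijOn (fl a) (flows_bij (G := G) ha)
    (f := fun p => ∏ i ∈ Finset.univ.erase (0 : Fin (n+1)), qnat (∑ k ∈ Ds p i, a k))]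
  · have hset : {p | goodP G p} =
      (((Tr Finset.univ (0 : Fin (n+1))).filter
        (fun p => ∀ i ∈ Finset.univ.erase (0 : Fin (n+1)), p i < i ∧ G.Adj i (p i)) :
        Finset (Fin (n+1) → Fin (n+1))) : Set _) := by
      ext p
      simp only [Set.mem_ofPred_eq, Finset.coe_filter, mem_Tr, isT,
        Finset.mem_erase, Finset.mem_univ, and_true, not_not, forall_eq, forall_const, true_and]
      constructor
      · intro h
        exact ⟨⟨h.1, h.reach⟩, h.2⟩
      · rintro ⟨h, h'⟩
        exact ⟨h.1, h'⟩
    rw [hset, finsum_mem_coe_finset, WT, Finset.sum_filter]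
    apply Finset.sum_congr rfl
    intro p hp
    split_ifs with h
    · apply Finset.prod_congr rfl
      intro i hi
      rw [phiF, if_pos (h i hi)]
    · push Not at h
      obtain ⟨i, hi, hadj⟩ := h
      symm
      apply Finset.prod_eq_zero hi
      rw [phiF, if_neg (fun h => hadj h.1 h.2)]
  · intro p hp
    rw [← Finset.mul_prod_erase _ _ (Finset.mem_univ (0 : Fin (n+1)))]
    have e0 : ∏ j, (if 0 < fl a p 0 j then qnat (fl a p 0 j) else 1) = 1 := by
      apply Finset.prod_eq_one
      intro j _
      rw [if_neg]
      rw [fl_pos ha]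
      simp
    rw [e0, one_mul]
    apply Finset.prod_congr rfl
    intro i hi
    have hi0 : i ≠ 0 := Finset.ne_of_mem_erase hi
    rw [Finset.prod_eq_single_of_mem (p i) (Finset.mem_univ _)]
    · rw [if_pos ((fl_pos ha).2 ⟨hi0, rfl⟩), fl, if_pos ⟨hi0, rfl⟩]
    · intro j _ hj
      rw [if_neg]
      rw [fl_pos ha]
      exact fun h => hj h.2.symm
end Main

theorem ehr_q1_eq_sum_all_trees (n : ℕ) (hn : 1 ≤ n) (G : SimpleGraph (Fin (n+1)))
    (hG : IsThreshold n G) (hc : G.Connected) (a : Fin (n+1) → ℕ)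
    (ha : ∀ i : Fin (n+1), i ≠ 0 → 0 < a i) :
    Ehr1 n G a =
      ∑ᶠ p ∈ {p | IsSpanTree n G p},
        (∏ i ∈ Finset.univ.erase (0 : Fin (n+1)), qnat (a (max i (p i)))) *
          ∏ᶠ pr ∈ invSet n p, (X : Polynomial ℤ) ^ a (max (p pr.1) pr.2) := by
  rw [flows_eq ha, trees_eq, WF_eq_WA a hG Finset.univ 0 (Finset.mem_univ _) (fun x _ => Fin.zero_le x)]

end ThresholdFlow
end

section
/- Let G be a threshold graph on vertex set {0,1,…,n} (n≥1) labeled by reverse degree sequence with degree sequence (d_0,d_1,…,d_n), and let a=(a_1,…,a_n) be positive integers. Then Ehr_{q,q^{−1}}(F_G(a)) = q^{−F} ∏_{i=1}^n b_i(q) as Laurent polynomials in q, where F = Σ_{i=1}^n min{d_i,i}·a_i − n and b_i(q) = [(i+1)a_i + Σ_{j=i+1}^{d_i} a_j]_q if d_i > i, b_i(q) = [a_i]_{q^{i+1}} if d_i = i, and b_i(q) = [a_i]_{q^{d_i+1}} [d_i]_q if d_i < i. -/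
open Finset Polynomial

namespace ThresholdFlow

/-- `b_i(q)` from the main theorem at `t = q⁻¹`. -/
noncomputable def bpoly (n : ℕ) (G : SimpleGraph (Fin (n+1))) (a : Fin (n+1) → ℕ)
    (i : Fin (n+1)) : LaurentPolynomial ℤ :=
  if (i : ℕ) < deg n G i then
    lq (((i : ℕ) + 1) * a i +
      ∑ j : Fin (n+1), if (i : ℕ) < (j : ℕ) ∧ (j : ℕ) ≤ deg n G i then a j else 0)
  else if deg n G i = (i : ℕ) then lqpow ((i : ℕ) + 1) (a i)
  else lqpow (deg n G i + 1) (a i) * lq (deg n G i)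

abbrev L := LaurentPolynomial ℤ
open LaurentPolynomial (T)

noncomputable def MM : L := -((1 - T 1) * (1 - T (-1)))
noncomputable def gg (b : ℕ) : L := if b = 0 then 1 else MM * wtqq b

lemma T_ne_one {m : ℤ} (hm : m ≠ 0) : (1 : L) - T m ≠ 0 := by
  intro h
  have h2 : (T 0 : L) = T m := by simpa [sub_eq_zero] using h
  have h3 := congrArg LaurentPolynomial.degree h2
  rw [LaurentPolynomial.degree_T, LaurentPolynomial.degree_T] at h3
  exact hm (by exact_mod_cast h3.symm)

lemma MM_ne : MM ≠ 0 := by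
  unfold MM
  exact neg_ne_zero.2 (mul_ne_zero (T_ne_one (by norm_num)) (T_ne_one (by norm_num)))

lemma T_pow' (m : ℤ) (k : ℕ) : (T m : L) ^ k = T (k * m) := LaurentPolynomial.T_pow m k

lemma lqpow_mul (m b : ℕ) : (1 - T (m:ℤ)) * lqpow m b = 1 - T ((m:ℤ) * b) := by
  induction b with
  | zero => simp [lqpow]
  | succ b ih =>
    have : lqpow m (b+1) = lqpow m b + T ((m:ℤ) * b) := by simp [lqpow, Finset.sum_range_succ]
    rw [this, mul_add, ih, sub_mul, ← LaurentPolynomial.T_add]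
    push_cast; ring_nf

lemma lq_mul (b : ℕ) : (1 - T 1) * lq b = 1 - T (b:ℤ) := by
  have := lqpow_mul 1 b
  simpa [lqpow, lq] using this

lemma lq_ne {b : ℕ} (hb : b ≠ 0) : lq b ≠ 0 := by
  intro h
  have := lq_mul b
  rw [h, mul_zero] at this
  exact T_ne_one (by exact_mod_cast hb) this.symm

lemma lq_lqpow (m b : ℕ) : lq m * lqpow m b = lq (m * b) := by
  have h1 : (1 - T 1 : L) ≠ 0 := T_ne_one (by norm_num)
  apply mul_left_cancel₀ h1
  rw [← mul_assoc, lq_mul, lqpow_mul, lq_mul]; push_cast; rfl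

lemma hser (α β : L) :
    (PowerSeries.mk (fun b => ∑ i ∈ range b, α ^ i * β ^ (b - 1 - i)) : PowerSeries L) *
      ((1 - PowerSeries.C α * PowerSeries.X) * (1 - PowerSeries.C β * PowerSeries.X)) = PowerSeries.X := by
  have h1 : (PowerSeries.mk (fun b => β ^ b) : PowerSeries L) * (1 - PowerSeries.C β * PowerSeries.X) = 1 := by
    ext b : 1
    rw [mul_sub, mul_one, ← mul_assoc, mul_comm _ (PowerSeries.C β), mul_assoc]
    rcases b with _ | b
    · simp
    · simp [PowerSeries.coeff_succ_mul_X, pow_succ', PowerSeries.coeff_one]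
  have h2 : (PowerSeries.mk (fun b => ∑ i ∈ range b, α ^ i * β ^ (b - 1 - i)) : PowerSeries L) *
      (1 - PowerSeries.C α * PowerSeries.X) = PowerSeries.mk (fun b => β ^ b) * PowerSeries.X := by
    ext b : 1
    rw [mul_sub, mul_one, ← mul_assoc, mul_comm _ (PowerSeries.C α), mul_assoc]
    rcases b with _ | b
    · simp
    · simp only [map_sub, PowerSeries.coeff_mk, PowerSeries.coeff_C_mul, PowerSeries.coeff_succ_mul_X]
      rw [Finset.sum_range_succ', Finset.mul_sum]
      simp only [pow_zero, one_mul, Nat.add_sub_cancel, Nat.sub_zero]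
      rw [add_comm, add_sub_assoc, ← Finset.sum_sub_distrib, Finset.sum_eq_zero, add_zero]
      intro i _
      rw [show b - (i+1) = b - 1 - i by omega]; ring
  rw [← mul_assoc, h2, mul_assoc, mul_comm PowerSeries.X, ← mul_assoc, h1, one_mul]

lemma lin_ne (α : L) : (1 - PowerSeries.C α * PowerSeries.X : PowerSeries L) ≠ 0 := by
  intro h
  have := congrArg (PowerSeries.coeff 0) h
  simp at this

noncomputable def phi (e : ℤ) : PowerSeries L := PowerSeries.mk (fun b => gg b * T (e * b))

lemma phi_mul (e : ℤ) : phi e * ((1 - PowerSeries.C (T (e+1)) * PowerSeries.X) * (1 - PowerSeries.C (T (e-1)) * PowerSeries.X)) =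
    (1 - PowerSeries.C (T e) * PowerSeries.X) ^ 2 := by
  have h : phi e = 1 + PowerSeries.C (MM * T e) *
      PowerSeries.mk (fun b => ∑ i ∈ range b, (T (e+1)) ^ i * (T (e-1)) ^ (b - 1 - i)) := by
    ext b : 1
    rcases b with _ | b
    · simp only [phi, PowerSeries.coeff_mk, map_add, PowerSeries.coeff_C_mul, gg,
        PowerSeries.coeff_one, if_true, Finset.range_zero, Finset.sum_empty, mul_zero,
        Nat.cast_zero, LaurentPolynomial.T_zero, mul_one, add_zero]
    · simp only [phi, PowerSeries.coeff_mk, map_add, PowerSeries.coeff_C_mul, gg, wtqq, PowerSeries.coeff_one]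
      simp only [Nat.add_eq_zero_iff, one_ne_zero, and_false, if_false, zero_add]
      rw [mul_assoc, mul_assoc, Finset.sum_mul, Finset.mul_sum _ _ (T e)]
      congr 1
      apply Finset.sum_congr rfl
      intro i hi
      rw [Finset.mem_range] at hi
      rw [T_pow', T_pow', ← LaurentPolynomial.T_add, ← LaurentPolynomial.T_add,
        ← LaurentPolynomial.T_add]
      congr 1
      have : ((b + 1 - 1 - i : ℕ) : ℤ) = b - i := by omega
      rw [this]; push_cast; ring
  rw [h, add_mul, mul_assoc, hser]
  have e1 : (T (e+1) : L) = T e * T 1 := LaurentPolynomial.T_add e 1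
  have e2 : (T (e-1) : L) = T e * T (-1) := by rw [← LaurentPolynomial.T_add]; rfl
  have e3 : (T 1 : L) * T (-1) = 1 := by rw [← LaurentPolynomial.T_add]; simp
  have e4 : (PowerSeries.C (T 1) : PowerSeries L) * PowerSeries.C (T (-1)) = 1 := by rw [← map_mul, e3, map_one]
  rw [e1, e2, MM]
  simp only [map_mul, map_neg, map_sub, map_one]
  linear_combination (PowerSeries.C (T e) ^ 2 * PowerSeries.X ^ 2 - PowerSeries.X * PowerSeries.C (T e)) * e4

/-- the exponents attached to a subset -/
def ee (S : Finset ℕ) (l : ℕ) : ℤ :=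
  if l ∈ S then 1 + (#{j ∈ S | j < l} : ℤ) else (#{j ∈ S | j < l} : ℤ) - l

lemma cnt_succ (S : Finset ℕ) (l : ℕ) :
    (#{j ∈ S | j < l + 1} : ℤ) = #{j ∈ S | j < l} + if l ∈ S then 1 else 0 := by
  have : ({j ∈ S | j < l + 1} : Finset ℕ) = {j ∈ S | j < l} ∪ {j ∈ S | j = l} := by
    ext x; simp only [mem_filter, mem_union]; constructor <;> intro h
    · rcases Nat.lt_or_ge x l with h1 | h1
      · exact Or.inl ⟨h.1, h1⟩
      · exact Or.inr ⟨h.1, by omega⟩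
    · rcases h with h | h <;> exact ⟨h.1, by omega⟩
  rw [this, card_union_of_disjoint]
  · rw [Finset.filter_eq']; split_ifs <;> simp
  · rw [Finset.disjoint_left]; intro x; simp only [mem_filter]; omega

lemma prod_phi (S : Finset ℕ) (k : ℕ) :
    (∏ l ∈ range k, phi (ee S l)) *
      ((1 - PowerSeries.C (T ((#{j ∈ S | j < k} : ℤ) + 1)) * PowerSeries.X) * (1 - PowerSeries.C (T ((#{j ∈ S | j < k} : ℤ) - k)) * PowerSeries.X))
    = (1 - PowerSeries.C (T ((#{j ∈ S | j < k} : ℤ) - k + 1)) * PowerSeries.X) * (1 - PowerSeries.C (T (#{j ∈ S | j < k} : ℤ)) * PowerSeries.X) := by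
  induction k with
  | zero => simp
  | succ k ih =>
    rw [Finset.prod_range_succ, cnt_succ]
    set s : ℤ := (#{j ∈ S | j < k} : ℤ) with hs
    have hp := phi_mul (ee S k)
    by_cases hk : k ∈ S
    · have he : ee S k = s + 1 := by simp [ee, hk, hs]; ring
      rw [he] at hp ⊢
      simp only [hk, if_true]
      rw [show s + 1 - 1 = s by ring] at hp
      apply mul_right_cancel₀ (mul_ne_zero (lin_ne (T (s+1))) (lin_ne (T s)))
      rw [show s + 1 - ((k+1:ℕ):ℤ) = s - k by push_cast; ring]
      linear_combination (1 - PowerSeries.C (T (s+1)) * PowerSeries.X)^2 * ih + (∏ l ∈ range k, phi (ee S l)) * (1 - PowerSeries.C (T (s+1)) * PowerSeries.X)*(1 - PowerSeries.C (T (s-k)) * PowerSeries.X) * hp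
    · have he : ee S k = s - k := by simp [ee, hk, hs]
      rw [he] at hp ⊢
      simp only [hk, if_false, add_zero]
      apply mul_right_cancel₀ (mul_ne_zero (lin_ne (T (s-k+1))) (lin_ne (T (s-k))))
      rw [show s - ((k+1:ℕ):ℤ) = s - k - 1 by push_cast; ring, show s - k - 1 + 1 = s - k by ring]
      linear_combination (1 - PowerSeries.C (T (s-k)) * PowerSeries.X)^2 * ih + (∏ l ∈ range k, phi (ee S l)) * (1 - PowerSeries.C (T (s+1)) * PowerSeries.X)*(1 - PowerSeries.C (T (s-k)) * PowerSeries.X) * hp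

lemma prod_phi_eq (S : Finset ℕ) (k : ℕ) (s : ℤ) (hs : s = #{j ∈ S | j < k}) :
    (∏ l ∈ range k, phi (ee S l)) = 1 + PowerSeries.C ((1 - T 1) * (1 - T (k:ℤ)) * T (s - k)) *
      PowerSeries.mk (fun b => ∑ i ∈ range b, (T (s+1)) ^ i * (T (s-k)) ^ (b - 1 - i)) := by
  apply mul_right_cancel₀ (mul_ne_zero (lin_ne (T (s+1))) (lin_ne (T (s-k))))
  have := prod_phi S k
  rw [← hs] at this
  rw [this, add_mul, mul_assoc, hser]
  have e0 : (T s : L) = T (s-k) * T k := by rw [← LaurentPolynomial.T_add]; congr 1; ring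
  have e1 : (T (s+1) : L) = T (s-k) * T k * T 1 := by rw [LaurentPolynomial.T_add, e0]
  have e2 : (T (s-k+1) : L) = T (s-k) * T 1 := by rw [LaurentPolynomial.T_add]
  rw [e1, e2, e0]
  simp only [map_mul, map_sub, map_one]
  ring

lemma coeff_prod_phi (S : Finset ℕ) (k m : ℕ) (hm : 0 < m) :
    ∑ c ∈ finsuppAntidiag (range k) m, ∏ l ∈ range k, (gg (c l) * T (ee S l * c l)) =
     (1 - T 1) * (1 - T (k:ℤ)) * lqpow (k+1) m * T (((#{j ∈ S | j < k} : ℤ) - k) * m) := by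
  have h := congrArg (PowerSeries.coeff m) (prod_phi_eq S k _ rfl)
  rw [PowerSeries.coeff_prod] at h
  simp only [phi, PowerSeries.coeff_mk] at h
  rw [h, map_add, PowerSeries.coeff_C_mul, PowerSeries.coeff_mk, PowerSeries.coeff_one,
    if_neg (by omega), zero_add, mul_assoc, mul_assoc, mul_assoc, mul_assoc, lqpow, Finset.sum_mul, Finset.mul_sum _ _ (T _)]
  congr 2
  apply Finset.sum_congr rfl
  intro i hi
  rw [Finset.mem_range] at hi
  rw [T_pow', T_pow', ← LaurentPolynomial.T_add, ← LaurentPolynomial.T_add,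
        ← LaurentPolynomial.T_add]
  congr 1
  have : ((m - 1 - i : ℕ) : ℤ) = m - 1 - i := by omega
  rw [this]; push_cast; ring


lemma T_sum {ι : Type*} (t : Finset ι) (f : ι → ℤ) :
    ∏ j ∈ t, (T (f j) : L) = T (∑ j ∈ t, f j) := by
  classical
  induction t using Finset.induction_on with
  | empty => simp
  | insert x t hx ih => rw [prod_insert hx, sum_insert hx, ih, LaurentPolynomial.T_add]

lemma expo (k : ℕ) (S : Finset ℕ) (hS : S ⊆ Ico 1 k) (c : ℕ → ℤ) :
    -(∑ j ∈ range k, (j : ℤ) * c j) + ∑ j ∈ S, (((j : ℤ) + 1) * c j + ∑ l ∈ Ioo j k, c l) =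
      ∑ l ∈ range k, ee S l * c l := by
  have h1 : ∑ j ∈ S, ∑ l ∈ Ioo j k, c l = ∑ l ∈ range k, (#{j ∈ S | j < l} : ℤ) * c l := by
    have : ∀ j ∈ S, ∑ l ∈ Ioo j k, c l = ∑ l ∈ range k, if j < l then c l else 0 := by
      intro j _
      rw [← Finset.sum_filter]
      apply Finset.sum_congr _ (fun _ _ => rfl)
      ext x; simp; omega
    rw [Finset.sum_congr rfl this, Finset.sum_comm]
    apply Finset.sum_congr rfl
    intro l _
    rw [← Finset.sum_filter, Finset.sum_const, nsmul_eq_mul]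
  have h2 : ∑ j ∈ S, ((j : ℤ) + 1) * c j =
      ∑ j ∈ range k, if j ∈ S then ((j : ℤ) + 1) * c j else 0 := by
    rw [← Finset.sum_filter]
    apply Finset.sum_congr _ (fun _ _ => rfl)
    ext x
    simp only [mem_filter, mem_range]
    constructor
    · intro h; exact ⟨(mem_Ico.1 (hS h)).2, h⟩
    · exact fun h => h.2
  rw [Finset.sum_add_distrib, h1, h2, ← Finset.sum_neg_distrib, ← Finset.sum_add_distrib,
    ← Finset.sum_add_distrib]
  apply Finset.sum_congr rfl
  intro l _
  unfold ee
  split_ifs <;> ring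

lemma prod_lq (s : Finset ℕ) (N : ℕ → ℕ) :
    (1 - T 1) ^ #s * ∏ j ∈ s, lq (N j) =
      ∑ t ∈ s.powerset, (-1) ^ #t * T (∑ j ∈ t, (N j : ℤ)) := by
  rw [← Finset.prod_const, ← Finset.prod_mul_distrib]
  simp only [lq_mul]
  rw [Finset.prod_sub]
  apply Finset.sum_congr rfl
  intro t _
  rw [T_sum]; simp

lemma MM_lq (k : ℕ) : MM * lq k * T 1 = (1 - T 1) * (1 - T (k : ℤ)) := by
  rw [← lq_mul]
  have e3 : (T 1 : L) * T (-1) = 1 := by rw [← LaurentPolynomial.T_add]; simp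
  unfold MM
  linear_combination ((1 - T 1) * lq k) * e3

lemma key (k m : ℕ) (hm : 0 < m) (A : ℕ → ℕ) :
    ∑ c ∈ finsuppAntidiag (range k) m, ((∏ j ∈ range k, gg (c j)) *
      T (-(∑ j ∈ range k, (j : ℤ) * c j)) *
      ∏ j ∈ Ico 1 k, lq (A j + ((j + 1) * c j + ∑ l ∈ Ioo j k, c l))) =
    MM * lq k * lqpow (k + 1) m * T (1 - k * m) * ∏ j ∈ Ico 1 k, lq (A j + m) := by
  apply mul_left_cancel₀ (pow_ne_zero #(Ico 1 k) (T_ne_one (m := 1) (by norm_num)))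
  rw [Finset.mul_sum]
  have h1 : ∀ c ∈ finsuppAntidiag (range k) m, (1 - T 1) ^ #(Ico 1 k) * ((∏ j ∈ range k, gg (c j)) *
      T (-(∑ j ∈ range k, (j : ℤ) * c j)) *
      ∏ j ∈ Ico 1 k, lq (A j + ((j + 1) * c j + ∑ l ∈ Ioo j k, c l))) =
      ∑ t ∈ (Ico 1 k).powerset, ((-1) ^ #t * T (∑ j ∈ t, (A j : ℤ))) *
        ∏ l ∈ range k, (gg (c l) * T (ee t l * c l)) := by
    intro c _
    rw [mul_left_comm, prod_lq, Finset.mul_sum]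
    apply Finset.sum_congr rfl
    intro t ht
    rw [Finset.prod_mul_distrib, T_sum, ← expo k t (mem_powerset.1 ht) (fun l => (c l : ℤ)),
      LaurentPolynomial.T_add]
    push_cast
    rw [Finset.sum_add_distrib, LaurentPolynomial.T_add]
    ring
  rw [Finset.sum_congr rfl h1, Finset.sum_comm]
  rw [mul_left_comm, prod_lq, Finset.mul_sum]
  apply Finset.sum_congr rfl
  intro t ht
  rw [← Finset.mul_sum, coeff_prod_phi t k m hm]
  have h2 : #{j ∈ t | j < k} = #t := by
    rw [Finset.filter_true_of_mem]
    intro x hx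
    exact (mem_Ico.1 ((mem_powerset.1 ht) hx)).2
  rw [h2, ← MM_lq]
  push_cast
  rw [Finset.sum_add_distrib, Finset.sum_const, nsmul_eq_mul, LaurentPolynomial.T_add,
    sub_mul, sub_eq_add_neg, sub_eq_add_neg, LaurentPolynomial.T_add, LaurentPolynomial.T_add]
  ring

noncomputable def EE (k : ℕ → ℕ) : ℕ → (ℕ → ℕ) → L
  | 0, _ => 1
  | n + 1, a => ∑ c ∈ finsuppAntidiag (range (k (n+1))) (a (n+1)),
      (∏ j ∈ range (k (n+1)), gg (c j)) * EE k n (fun i => a i + c i)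

def UU (k : ℕ → ℕ) (n i : ℕ) : Finset ℕ := (Ioc i n).filter (fun l => i < k l)

open Classical in
noncomputable def bb (k : ℕ → ℕ) (n : ℕ) (a : ℕ → ℕ) (i : ℕ) : L :=
  if (UU k n i).Nonempty then lq ((i + 1) * a i + ∑ l ∈ UU k n i, a l)
  else if k i = i then lqpow (i + 1) (a i) else lqpow (k i + 1) (a i) * lq (k i)

lemma UU_self (k : ℕ → ℕ) (n : ℕ) : UU k n n = ∅ := by simp [UU]

lemma UU_low (k : ℕ → ℕ) (hk2 : ∀ i l, i ≤ l → min i (k l) ≤ k i) (n j : ℕ)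
    (hj : j < k (n+1)) : UU k n j = Ioc j n := by
  unfold UU
  apply Finset.filter_true_of_mem
  intro l hl
  rw [mem_Ioc] at hl
  have := hk2 l (n+1) (by omega)
  omega

lemma UU_low' (k : ℕ → ℕ) (hk2 : ∀ i l, i ≤ l → min i (k l) ≤ k i) (n j : ℕ)
    (hj : j < k (n+1)) : UU k (n+1) j = Ioc j (n+1) := by
  unfold UU
  apply Finset.filter_true_of_mem
  intro l hl
  rw [mem_Ioc] at hl
  have := hk2 l (n+1) (by omega)
  omega

lemma UU_high (k : ℕ → ℕ) (n j : ℕ) (hj : k (n+1) ≤ j) : UU k (n+1) j = UU k n j := by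
  unfold UU
  ext l
  simp only [mem_filter, mem_Ioc]
  constructor
  · rintro ⟨⟨h1, h2⟩, h3⟩
    have : l ≠ n + 1 := by rintro rfl; omega
    exact ⟨⟨h1, by omega⟩, h3⟩
  · rintro ⟨⟨h1, h2⟩, h3⟩
    exact ⟨⟨h1, by omega⟩, h3⟩

set_option maxHeartbeats 1000000 in
theorem EE_eq (k : ℕ → ℕ) (hk : ∀ i, k i ≤ i) (hk2 : ∀ i l, i ≤ l → min i (k l) ≤ k i) (n : ℕ) :
    ∀ a : ℕ → ℕ, (∀ i, 1 ≤ i → 0 < a i) →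
    EE k n a = MM ^ n * T (-(∑ i ∈ Icc 1 n, (k i : ℤ) * a i) + n) * ∏ i ∈ Icc 1 n, bb k n a i := by
  induction n with
  | zero => intro a _; simp [EE]
  | succ n ih =>
    intro a ha
    set K := k (n+1) with hK
    have hKn : K ≤ n + 1 := hk _
    have hlow : ∀ j, j < K → k j = j := by
      intro j hj
      have := hk2 j (n+1) (by omega)
      have := hk j
      omega
    set δ : L := if K = n + 1 then lq K else 1 with hδ
    have hδ0 : δ ≠ 0 := by
      rw [hδ]; split_ifs with h
      · exact lq_ne (by omega)
      · exact one_ne_zero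
    have hlast : δ * bb k (n+1) a (n+1) = lq K * lqpow (K+1) (a (n+1)) := by
      unfold bb
      rw [UU_self, if_neg (by simp), hδ, ← hK]
      split_ifs with h
      · rw [h]
      · ring
    have hsplit : ∀ F : ℕ → L, ∏ i ∈ Icc 1 n, F i =
        (∏ i ∈ Ico 1 K, F i) * ∏ i ∈ (Icc 1 n).filter (fun i => K ≤ i), F i := by
      intro F
      rw [← Finset.prod_filter_mul_prod_filter_not (Icc 1 n) (fun i => i < K)]
      congr 1
      · apply Finset.prod_congr _ (fun _ _ => rfl)
        ext x; simp; omega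
      · apply Finset.prod_congr _ (fun _ _ => rfl)
        ext x; simp
    have hprod : ∀ c ∈ finsuppAntidiag (range K) (a (n+1)),
        δ * ∏ i ∈ Ico 1 K, bb k n (fun i => a i + c i) i =
        ∏ j ∈ Ico 1 K, lq (((j + 1) * a j + ∑ l ∈ Ioc j n, a l) +
          ((j + 1) * c j + ∑ l ∈ Ioo j K, c l)) := by
      intro c hc
      have hsupp : ∀ l, K ≤ l → c l = 0 := by
        intro l hl
        by_contra h
        have := (mem_finsuppAntidiag.1 hc).2 (Finsupp.mem_support_iff.2 h)
        rw [mem_range] at this; omega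
      have hsum : ∀ j, ∑ l ∈ Ioc j n, c l = ∑ l ∈ Ioo j K, c l := by
        intro j
        symm
        apply Finset.sum_subset
        · intro x hx; rw [mem_Ioo] at hx; rw [mem_Ioc]; omega
        · intro x hx hx2
          rw [mem_Ioc] at hx; rw [mem_Ioo] at hx2
          exact hsupp x (by omega)
      have hgen : ∀ j, j < K → j < n → bb k n (fun i => a i + c i) j =
          lq (((j + 1) * a j + ∑ l ∈ Ioc j n, a l) + ((j + 1) * c j + ∑ l ∈ Ioo j K, c l)) := by
        intro j hj hjn
        unfold bb
        rw [UU_low k hk2 n j hj, if_pos ⟨n, by rw [mem_Ioc]; omega⟩, ← hsum,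
          Finset.sum_add_distrib]
        congr 1; ring
      rw [hδ]
      split_ifs with h
      · rcases n with _ | n
        · rw [h]; simp [lq]
        · rw [h, Finset.prod_Ico_succ_top (show 1 ≤ n+1 by omega), Finset.prod_Ico_succ_top (show 1 ≤ n+1 by omega),
            mul_left_comm]
          congr 1
          · apply Finset.prod_congr rfl
            intro j hj
            rw [mem_Ico] at hj
            rw [hgen j (by omega) (by omega), h]
          · unfold bb
            rw [UU_self, if_neg (by simp), if_pos (hlow (n+1) (by omega)), lq_lqpow]
            congr 1
            have h0 : Ioo (n+1) (n+1+1) = ∅ := by ext x; simp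
            rw [h0, Finset.Ioc_self, Finset.sum_empty, Finset.sum_empty]
            ring
      · rw [one_mul]
        apply Finset.prod_congr rfl
        intro j hj
        rw [mem_Ico] at hj
        exact hgen j (by omega) (by omega)
    have hterm : ∀ c ∈ finsuppAntidiag (range K) (a (n+1)),
        δ * ((∏ j ∈ range K, gg (c j)) * EE k n (fun i => a i + c i)) =
        (MM ^ n * T (-(∑ i ∈ Icc 1 n, (k i : ℤ) * a i) + n) *
          ∏ i ∈ (Icc 1 n).filter (fun i => K ≤ i), bb k (n+1) a i) *
        ((∏ j ∈ range K, gg (c j)) * T (-(∑ j ∈ range K, (j : ℤ) * c j)) *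
        ∏ j ∈ Ico 1 K, lq (((j + 1) * a j + ∑ l ∈ Ioc j n, a l) +
          ((j + 1) * c j + ∑ l ∈ Ioo j K, c l))) := by
      intro c hc
      have hsupp : ∀ l, K ≤ l → c l = 0 := by
        intro l hl
        by_contra h
        have := (mem_finsuppAntidiag.1 hc).2 (Finsupp.mem_support_iff.2 h)
        rw [mem_range] at this; omega
      rw [ih _ (fun i hi => Nat.add_pos_left (ha i hi) _), hsplit, ← hprod c hc]
      have h1 : ∏ i ∈ (Icc 1 n).filter (fun i => K ≤ i), bb k n (fun i => a i + c i) i =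
          ∏ i ∈ (Icc 1 n).filter (fun i => K ≤ i), bb k (n+1) a i := by
        apply Finset.prod_congr rfl
        intro j hj
        rw [mem_filter] at hj
        unfold bb
        rw [UU_high k n j hj.2]
        have h3 : ∑ l ∈ UU k n j, (a l + c l) = ∑ l ∈ UU k n j, a l := by
          apply Finset.sum_congr rfl
          intro l hl
          have := (mem_Ioc.1 (mem_filter.1 hl).1).1
          rw [hsupp l (by omega), add_zero]
        simp only [hsupp j hj.2, h3, add_zero]
      have h2 : ∑ i ∈ Icc 1 n, (k i : ℤ) * ((a i + c i : ℕ) : ℤ) =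
          ∑ i ∈ Icc 1 n, (k i : ℤ) * a i + ∑ j ∈ range K, (j : ℤ) * c j := by
        push_cast
        simp only [mul_add]
        rw [Finset.sum_add_distrib]
        congr 1
        have h4 : ∑ i ∈ Icc 1 n, (k i : ℤ) * (c i : ℤ) = ∑ i ∈ Ico 1 K, (k i : ℤ) * (c i : ℤ) := by
          symm
          apply Finset.sum_subset
          · intro x hx; rw [mem_Ico] at hx; rw [mem_Icc]; omega
          · intro x hx hx2
            rw [mem_Icc] at hx; rw [mem_Ico] at hx2
            rw [hsupp x (by omega)]; simp
        have h5 : ∑ i ∈ range K, (i : ℤ) * (c i : ℤ) = ∑ i ∈ Ico 1 K, (i : ℤ) * (c i : ℤ) := by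
          symm
          apply Finset.sum_subset
          · intro x hx; rw [mem_Ico] at hx; rw [mem_range]; omega
          · intro x hx hx2
            rw [mem_range] at hx; rw [mem_Ico] at hx2
            rw [show x = 0 by omega]; simp
        rw [h4, h5]
        apply Finset.sum_congr rfl
        intro j hj
        rw [mem_Ico] at hj
        rw [hlow j hj.2]
      rw [h1, h2, neg_add, add_right_comm, LaurentPolynomial.T_add]
      ring
    apply mul_left_cancel₀ hδ0
    rw [EE, Finset.mul_sum, Finset.sum_congr rfl hterm, ← Finset.mul_sum,
      key K _ (ha _ (by omega)), Finset.prod_Icc_succ_top (by omega), hsplit,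
      Finset.sum_Icc_succ_top (by omega)]
    have h6 : ∏ j ∈ Ico 1 K, lq ((j + 1) * a j + ∑ l ∈ Ioc j n, a l + a (n + 1)) =
        ∏ j ∈ Ico 1 K, bb k (n+1) a j := by
      apply Finset.prod_congr rfl
      intro j hj
      rw [mem_Ico] at hj
      unfold bb
      rw [UU_low' k hk2 n j hj.2, if_pos ⟨n+1, by rw [mem_Ioc]; omega⟩,
        Finset.sum_Ioc_succ_top (by omega : j ≤ n)]
      congr 1; ring
    rw [h6]
    have h7 : (-(∑ i ∈ Icc 1 n, (k i : ℤ) * a i + (K : ℤ) * a (n+1)) + ((n+1 : ℕ) : ℤ)) =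
       (-(∑ i ∈ Icc 1 n, (k i : ℤ) * a i) + n) + (1 - K * a (n+1)) := by push_cast; ring
    rw [h7, LaurentPolynomial.T_add (-(∑ i ∈ Icc 1 n, (k i : ℤ) * a i) + n)]
    linear_combination (-(MM ^ (n+1) * T (-(∑ i ∈ Icc 1 n, (k i : ℤ) * a i) + n) *
      T (1 - (K:ℤ) * a (n+1)) * (∏ j ∈ Ico 1 K, bb k (n+1) a j) *
      ∏ i ∈ (Icc 1 n).filter (fun i => K ≤ i), bb k (n+1) a i)) * hlast

open Classical in
noncomputable def FL (k : ℕ → ℕ) : ℕ → (ℕ → ℕ) → Finset (ℕ → ℕ → ℕ)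
  | 0, _ => {fun _ _ => 0}
  | n + 1, a => (finsuppAntidiag (range (k (n+1))) (a (n+1))).biUnion fun c =>
      (FL k n (fun i => a i + c i)).image (fun f => Function.update f (n+1) c)

lemma mem_FL (k : ℕ → ℕ) (hk : ∀ i, k i ≤ i) (n : ℕ) : ∀ (a : ℕ → ℕ) (f : ℕ → ℕ → ℕ),
    f ∈ FL k n a ↔ (∀ i j, f i j ≠ 0 → 1 ≤ i ∧ i ≤ n ∧ j < k i) ∧
      ∀ i ∈ Icc 1 n, ∑ j ∈ range (k i), f i j = a i + ∑ l ∈ Icc 1 n, f l i := by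
  induction n with
  | zero =>
    intro a f
    simp only [FL, mem_singleton]
    constructor
    · rintro rfl; simp
    · rintro ⟨h, _⟩
      funext i j
      by_contra h2
      have := h i j h2
      omega
  | succ n ih =>
    intro a f
    simp only [FL, mem_biUnion, mem_image]
    constructor
    · rintro ⟨c, hc, f', hf', rfl⟩
      rw [ih] at hf'
      obtain ⟨h1, h2⟩ := hf'
      rw [mem_finsuppAntidiag] at hc
      obtain ⟨hc1, hc2⟩ := hc
      have hs : ∀ i j, Function.update f' (n+1) c i j ≠ 0 → 1 ≤ i ∧ i ≤ n + 1 ∧ j < k i := by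
        intro i j hij
        by_cases hi : i = n + 1
        · subst hi
          rw [Function.update_self] at hij
          have := hc2 (Finsupp.mem_support_iff.2 hij)
          rw [mem_range] at this
          omega
        · rw [Function.update_of_ne hi] at hij
          have := h1 i j hij
          omega
      refine ⟨hs, ?_⟩
      intro i hi
      rw [mem_Icc] at hi
      by_cases hin : i = n + 1
      · subst hin
        rw [Finset.sum_eq_zero (s := Icc 1 (n+1)), Function.update_self, hc1, add_zero]
        intro l hl
        rw [mem_Icc] at hl
        by_contra h3
        have := hs _ _ h3
        have := hk l
        omega
      · rw [Function.update_of_ne hin, h2 i (by rw [mem_Icc]; omega),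
          Finset.sum_Icc_succ_top (by omega), Function.update_self]
        have : ∑ l ∈ Icc 1 n, Function.update f' (n+1) c l i = ∑ l ∈ Icc 1 n, f' l i := by
          apply Finset.sum_congr rfl
          intro l hl
          rw [mem_Icc] at hl
          rw [Function.update_of_ne (by omega)]
        rw [this]; ring
    · rintro ⟨h1, h2⟩
      refine ⟨Finsupp.onFinset (range (k (n+1))) (f (n+1)) ?_, ?_, Function.update f (n+1) 0, ?_, ?_⟩
      · intro j hj
        rw [mem_range]
        exact (h1 _ _ hj).2.2
      · rw [mem_finsuppAntidiag]
        refine ⟨?_, Finsupp.support_onFinset_subset⟩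
        change ∑ j ∈ range (k (n+1)), f (n+1) j = _
        rw [h2 (n+1) (by rw [mem_Icc]; omega), Finset.sum_eq_zero, add_zero]
        intro l hl
        rw [mem_Icc] at hl
        by_contra h3
        have := h1 _ _ h3
        have := hk l
        omega
      · rw [ih]
        constructor
        · intro i j hij
          by_cases hi : i = n + 1
          · subst hi
            rw [Function.update_self] at hij
            simp at hij
          · rw [Function.update_of_ne hi] at hij
            have := h1 i j hij
            omega
        · intro i hi
          rw [mem_Icc] at hi
          rw [Function.update_of_ne (by omega), h2 i (by rw [mem_Icc]; omega),
            Finset.sum_Icc_succ_top (by omega)]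
          have : ∑ l ∈ Icc 1 n, Function.update f (n+1) 0 l i = ∑ l ∈ Icc 1 n, f l i := by
            apply Finset.sum_congr rfl
            intro l hl
            rw [mem_Icc] at hl
            rw [Function.update_of_ne (by omega)]
          rw [this]
          simp only [Finsupp.onFinset_apply]
          ring
      · rw [Function.update_idem]
        have : ((Finsupp.onFinset (range (k (n+1))) (f (n+1)) (by
          intro j hj
          rw [mem_range]
          exact (h1 _ _ hj).2.2) : ℕ →₀ ℕ) : ℕ → ℕ) = f (n+1) := by
          funext j; simp
        rw [this, Function.update_eq_self]

noncomputable def WW (k : ℕ → ℕ) (n : ℕ) (f : ℕ → ℕ → ℕ) : L :=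
  ∏ i ∈ Icc 1 n, ∏ j ∈ range (k i), gg (f i j)

lemma sum_FL (k : ℕ → ℕ) (hk : ∀ i, k i ≤ i) (n : ℕ) : ∀ (a : ℕ → ℕ),
    ∑ f ∈ FL k n a, WW k n f = EE k n a := by
  classical
  induction n with
  | zero => intro a; simp [FL, WW, EE]
  | succ n ih =>
    intro a
    rw [FL, EE, Finset.sum_biUnion]
    · apply Finset.sum_congr rfl
      intro c _
      rw [Finset.sum_image, ← ih, Finset.mul_sum]
      · apply Finset.sum_congr rfl
        intro f _
        unfold WW
        rw [Finset.prod_Icc_succ_top (by omega), Function.update_self, mul_comm]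
        congr 1
        apply Finset.prod_congr rfl
        intro i hi
        rw [mem_Icc] at hi
        rw [Function.update_of_ne (by omega)]
      · intro f hf g hg hfg
        have hf' := (mem_FL k hk n _ f).1 hf
        have hg' := (mem_FL k hk n _ g).1 hg
        funext i j
        by_cases hi : i = n + 1
        · subst hi
          have h1 : f (n+1) j = 0 := by
            by_contra h; have := hf'.1 _ _ h; omega
          have h2 : g (n+1) j = 0 := by
            by_contra h; have := hg'.1 _ _ h; omega
          rw [h1, h2]
        · have := congrFun (congrFun hfg i) j
          simpa [Function.update_of_ne hi] using this
    · intro c _ c' _ hcc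
      rw [Function.onFun, Finset.disjoint_left]
      intro f hf hf'
      rw [mem_image] at hf hf'
      obtain ⟨g, _, rfl⟩ := hf
      obtain ⟨g', _, h⟩ := hf'
      apply hcc
      have := congrFun h (n+1)
      rw [Function.update_self, Function.update_self] at this
      exact DFunLike.coe_injective this.symm

def AN (n : ℕ) (G : SimpleGraph (Fin (n+1))) (i j : ℕ) : Prop :=
  ∃ (hi : i < n + 1) (hj : j < n + 1), G.Adj ⟨i, hi⟩ ⟨j, hj⟩

open Classical in
noncomputable def kk (n : ℕ) (G : SimpleGraph (Fin (n+1))) (i : ℕ) : ℕ :=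
  #{j ∈ range i | AN n G i j}

open Classical in
lemma kk_le (n : ℕ) (G : SimpleGraph (Fin (n+1))) (i : ℕ) : kk n G i ≤ i := by
  unfold kk
  exact (Finset.card_filter_le _ _).trans (by simp)

lemma lower_eq (s : Finset ℕ) (i : ℕ) (h1 : ∀ x ∈ s, i ≤ x)
    (h2 : ∀ x ∈ s, ∀ y, i ≤ y → y ≤ x → y ∈ s) : s = Ico i (i + #s) := by
  symm
  apply Finset.eq_of_subset_of_card_le
  · intro x hx
    rw [mem_Ico] at hx
    by_contra hxs
    have h3 : s ⊆ Ico i x := by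
      intro y hy
      rw [mem_Ico]
      refine ⟨h1 y hy, ?_⟩
      by_contra h
      exact hxs (h2 y hy x hx.1 (by omega))
    have := Finset.card_le_card h3
    rw [Nat.card_Ico] at this
    omega
  · simp

open Classical in
lemma AN_iff (n : ℕ) (G : SimpleGraph (Fin (n+1))) (hG : IsThreshold n G) (i j : ℕ) (hj : j < i) :
    AN n G i j ↔ j < kk n G i := by
  have h := lower_eq ((range i).filter (fun j => AN n G i j)) 0 (fun _ _ => Nat.zero_le _) (by
    intro x hx y _ hyx
    rw [mem_filter, mem_range] at hx ⊢
    obtain ⟨hx1, hi, hxn, hadj⟩ := hx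
    refine ⟨by omega, hi, by omega, ?_⟩
    apply hG ⟨i, hi⟩ ⟨x, hxn⟩ _ _ (by simpa using hx1) hadj le_rfl (by simpa using hyx)
    simp; omega)
  have h2 := Finset.ext_iff.1 h j
  rw [mem_filter, mem_range, mem_Ico] at h2
  unfold kk
  constructor
  · intro h3
    have := (h2.1 ⟨hj, h3⟩).2
    convert (by omega : j < _)
    omega
  · intro h3
    apply (h2.2 ⟨by omega, _⟩).2
    rw [zero_add]; convert h3

lemma kk2 (n : ℕ) (G : SimpleGraph (Fin (n+1))) (hG : IsThreshold n G) (i l : ℕ) (hil : i ≤ l) :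
    min i (kk n G l) ≤ kk n G i := by
  by_contra h
  push Not at h
  have h1 : kk n G i < i := by omega
  have h2 := (AN_iff n G hG l (kk n G i) (by omega)).2 (by omega)
  obtain ⟨hl, hx, hadj⟩ := h2
  have : AN n G i (kk n G i) := by
    refine ⟨by omega, hx, ?_⟩
    apply hG ⟨l, hl⟩ ⟨_, hx⟩ _ _ (by simp; omega) hadj (by simpa using hil) le_rfl
    simp; omega
  rw [AN_iff n G hG _ _ h1] at this
  omega

lemma deg_eq (n : ℕ) (G : SimpleGraph (Fin (n+1))) (hG : IsThreshold n G) (i : Fin (n+1)) :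
    deg n G i = kk n G i + #(UU (kk n G) n i) := by
  classical
  unfold deg
  rw [← Set.ncard_image_of_injective _ Fin.val_injective]
  have : Fin.val '' {j | G.Adj i j} = ((range (kk n G i) ∪ UU (kk n G) n i : Finset ℕ) : Set ℕ) := by
    ext x
    simp only [Set.mem_image, Set.mem_ofPred_eq, coe_union, Set.mem_union, mem_coe, mem_range, UU,
      mem_filter, mem_Ioc]
    constructor
    · rintro ⟨j, hj, rfl⟩
      rcases lt_trichotomy j i with h | h | h
      · left
        rw [← AN_iff n G hG _ _ h]
        exact ⟨i.2, j.2, hj⟩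
      · subst h; exact absurd hj (G.irrefl)
      · right
        refine ⟨⟨h, by omega⟩, ?_⟩
        rw [← AN_iff n G hG _ _ h]
        exact ⟨j.2, i.2, hj.symm⟩
    · rintro (h | ⟨⟨h1, h2⟩, h3⟩)
      · have := kk_le n G i
        rw [← AN_iff n G hG _ _ (by omega)] at h
        obtain ⟨_, h5, h6⟩ := h
        exact ⟨⟨x, h5⟩, h6, rfl⟩
      · rw [← AN_iff n G hG _ _ (by omega)] at h3
        obtain ⟨h5, _, h6⟩ := h3
        exact ⟨⟨x, h5⟩, h6.symm, rfl⟩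
  rw [this, Set.ncard_coe_finset, card_union_of_disjoint, card_range]
  rw [Finset.disjoint_left]
  intro x hx hx2
  have := kk_le n G i
  rw [mem_range] at hx
  have := (mem_Ioc.1 (mem_filter.1 hx2).1).1
  omega

lemma UU_eq (k : ℕ → ℕ) (hk2 : ∀ i l, i ≤ l → min i (k l) ≤ k i) (n i : ℕ) :
    UU k n i = Ioc i (i + #(UU k n i)) := by
  have h := lower_eq (UU k n i) (i+1) (by
    intro x hx
    exact (mem_Ioc.1 (mem_filter.1 hx).1).1) (by
    intro x hx y hy hyx
    unfold UU at hx ⊢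
    rw [mem_filter, mem_Ioc] at hx ⊢
    have := hk2 y x hyx
    omega)
  refine h.trans ?_
  ext x
  rw [mem_Ico, mem_Ioc]; omega

def aN (n : ℕ) (a : Fin (n+1) → ℕ) (i : ℕ) : ℕ := if h : i < n + 1 then a ⟨i, h⟩ else 1

lemma aN_val (n : ℕ) (a : Fin (n+1) → ℕ) (i : Fin (n+1)) : aN n a i = a i := by
  unfold aN
  rw [dif_pos i.2]

lemma bpoly_eq (n : ℕ) (G : SimpleGraph (Fin (n+1))) (hG : IsThreshold n G) (a : Fin (n+1) → ℕ)
    (i : Fin (n+1)) : bpoly n G a i = bb (kk n G) n (aN n a) i := by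
  classical
  unfold bpoly bb
  have hd := deg_eq n G hG i
  have hk := kk_le n G i
  have hU := UU_eq (kk n G) (kk2 n G hG) n i
  by_cases h : (UU (kk n G) n i).Nonempty
  · obtain ⟨l, hl⟩ := h
    have hki : kk n G i = i := by
      unfold UU at hl
      rw [mem_filter, mem_Ioc] at hl
      have := kk2 n G hG i l (by omega)
      omega
    have hpos : 0 < #(UU (kk n G) n i) := Finset.card_pos.2 ⟨l, hl⟩
    rw [if_pos (by omega), if_pos ⟨l, hl⟩, aN_val]
    congr 2
    have h1 : ∀ j : Fin (n+1), (if (i : ℕ) < (j : ℕ) ∧ (j : ℕ) ≤ deg n G i then a j else 0) =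
        (fun j : ℕ => if (i : ℕ) < j ∧ j ≤ deg n G i then aN n a j else 0) j := by
      intro j; simp only [aN_val]
    rw [Finset.sum_congr rfl (fun j _ => h1 j),
      Fin.sum_univ_eq_sum_range (fun j : ℕ => if (i : ℕ) < j ∧ j ≤ deg n G i then aN n a j else 0) (n+1),
      ← Finset.sum_filter]
    apply Finset.sum_congr _ (fun _ _ => rfl)
    ext x
    have h3 := Finset.ext_iff.1 hU x
    rw [mem_Ioc] at h3
    rw [mem_filter, mem_range, h3]
    constructor
    · intro h4; omega
    · intro h4
      have := (mem_Ioc.1 (mem_filter.1 (h3.2 h4)).1).2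
      omega
  · rw [if_neg h]
    rw [Finset.not_nonempty_iff_eq_empty] at h
    rw [h, card_empty, add_zero] at hd
    rw [hd, if_neg (by omega), aN_val]

lemma min_deg (n : ℕ) (G : SimpleGraph (Fin (n+1))) (hG : IsThreshold n G) (i : Fin (n+1)) :
    min (deg n G i) (i : ℕ) = kk n G i := by
  have hd := deg_eq n G hG i
  have hk := kk_le n G i
  by_cases h : (UU (kk n G) n i).Nonempty
  · obtain ⟨l, hl⟩ := h
    unfold UU at hl
    rw [mem_filter, mem_Ioc] at hl
    have := kk2 n G hG i l (by omega)
    omega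
  · rw [Finset.not_nonempty_iff_eq_empty] at h
    rw [h, card_empty, add_zero] at hd
    omega

def ext (n : ℕ) (f : Fin (n+1) → Fin (n+1) → ℕ) (i j : ℕ) : ℕ :=
  if h : i < n + 1 ∧ j < n + 1 then f ⟨i, h.1⟩ ⟨j, h.2⟩ else 0

lemma ext_val (n : ℕ) (f : Fin (n+1) → Fin (n+1) → ℕ) (i j : Fin (n+1)) :
    ext n f i j = f i j := by
  unfold ext
  rw [dif_pos ⟨i.2, j.2⟩]

lemma ext_supp (n : ℕ) (G : SimpleGraph (Fin (n+1))) (hG : IsThreshold n G)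
    (f : Fin (n+1) → Fin (n+1) → ℕ) (hf : ∀ i j, f i j ≠ 0 → j < i ∧ G.Adj i j) (i j : ℕ)
    (h : ext n f i j ≠ 0) : 1 ≤ i ∧ i ≤ n ∧ j < kk n G i := by
  unfold ext at h
  split_ifs at h with h1
  · obtain ⟨h2, h3⟩ := hf _ _ h
    have h4 : j < i := h2
    refine ⟨by omega, by omega, ?_⟩
    rw [← AN_iff n G hG _ _ h4]
    exact ⟨h1.1, h1.2, h3⟩
  · exact absurd rfl h

lemma flow_iff (n : ℕ) (G : SimpleGraph (Fin (n+1))) (hG : IsThreshold n G) (a : Fin (n+1) → ℕ)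
    (f : Fin (n+1) → Fin (n+1) → ℕ) (hf : ∀ i j, f i j ≠ 0 → j < i ∧ G.Adj i j) :
    (∀ i : Fin (n+1), i ≠ 0 → ∑ j, f i j = a i + ∑ j, f j i) ↔
    ∀ i ∈ Icc 1 n, ∑ j ∈ range (kk n G i), ext n f i j = aN n a i + ∑ l ∈ Icc 1 n, ext n f l i := by
  have hs := ext_supp n G hG f hf
  have h1 : ∀ i : Fin (n+1), ∑ j, f i j = ∑ j ∈ range (kk n G i), ext n f i j := by
    intro i
    rw [Finset.sum_congr rfl (fun j _ => (ext_val n f i j).symm),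
      Fin.sum_univ_eq_sum_range (fun j => ext n f i j) (n+1)]
    symm
    apply Finset.sum_subset
    · intro x hx
      have := kk_le n G i
      rw [mem_range] at hx ⊢; omega
    · intro x _ hx
      by_contra h
      exact hx (mem_range.2 (hs _ _ h).2.2)
  have h2 : ∀ i : Fin (n+1), ∑ j, f j i = ∑ l ∈ Icc 1 n, ext n f l i := by
    intro i
    rw [Finset.sum_congr rfl (fun j _ => (ext_val n f j i).symm),
      Fin.sum_univ_eq_sum_range (fun j => ext n f j i) (n+1)]
    symm
    apply Finset.sum_subset
    · intro x hx
      rw [mem_Icc] at hx; rw [mem_range]; omega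
    · intro x _ hx
      by_contra h
      have := hs _ _ h
      exact hx (mem_Icc.2 (by omega))
  constructor
  · intro h i hi
    rw [mem_Icc] at hi
    have h3 := h ⟨i, by omega⟩ (by intro h0; have := congrArg Fin.val h0; simp at this; omega)
    rw [h1, h2, ← aN_val n a] at h3
    exact h3
  · intro h i hi
    have hi0 : (i : ℕ) ≠ 0 := fun h0 => hi (Fin.ext h0)
    have := h i (mem_Icc.2 (by omega))
    rw [h1, h2, this, aN_val]

lemma bij (n : ℕ) (G : SimpleGraph (Fin (n+1))) (hG : IsThreshold n G) (a : Fin (n+1) → ℕ) :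
    Set.BijOn (ext n) {f | IsFlow n G a f} (FL (kk n G) n (aN n a) : Set (ℕ → ℕ → ℕ)) := by
  refine ⟨?_, ?_, ?_⟩
  · rintro f ⟨h1, h2⟩
    rw [mem_coe, mem_FL _ (kk_le n G)]
    exact ⟨ext_supp n G hG f h1, (flow_iff n G hG a f h1).1 h2⟩
  · intro f _ g _ h
    funext i j
    rw [← ext_val n f, ← ext_val n g, h]
  · intro h hh
    rw [mem_coe, mem_FL _ (kk_le n G)] at hh
    obtain ⟨h1, h2⟩ := hh
    have he : ext n (fun i j => h i j) = h := by
      funext i j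
      unfold ext
      split_ifs with h3
      · rfl
      · by_contra h4
        have := h1 i j (Ne.symm h4)
        have := kk_le n G i
        omega
    have hf : ∀ i j : Fin (n+1), h i j ≠ 0 → j < i ∧ G.Adj i j := by
      intro i j hij
      have h3 := h1 _ _ hij
      have := kk_le n G i
      have h4 : (j : ℕ) < i := by omega
      have h5 := (AN_iff n G hG i j h4).2 h3.2.2
      obtain ⟨_, _, h6⟩ := h5
      exact ⟨h4, h6⟩
    refine ⟨fun i j => h i j, ⟨hf, ?_⟩, he⟩
    rw [flow_iff n G hG a (fun i j => h i j) hf, he]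
    exact h2

lemma weight_eq (n : ℕ) (G : SimpleGraph (Fin (n+1))) (hG : IsThreshold n G) (a : Fin (n+1) → ℕ)
    (ha : ∀ i : Fin (n+1), i ≠ 0 → 0 < a i)
    (f : Fin (n+1) → Fin (n+1) → ℕ) (hf : IsFlow n G a f) :
    MM ^ n * (MM ^ (posCount n f - n) * ∏ i, ∏ j, wtqq (f i j)) = WW (kk n G) n (ext n f) := by
  have hs := ext_supp n G hG f hf.1
  have hpos : n ≤ posCount n f := by
    have : ∀ i : Fin (n+1), ∃ j, i ≠ 0 → 0 < f i j := by
      intro i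
      by_contra h
      push Not at h
      have hi := (h 0).1
      have h2 := hf.2 i hi
      rw [Finset.sum_eq_zero (fun j _ => Nat.le_zero.1 (h j).2)] at h2
      have := ha i hi
      omega
    choose J hJ using this
    have hc : #(univ.erase (0 : Fin (n+1))) = n := by simp
    unfold posCount
    refine hc.symm.le.trans ?_
    apply Finset.card_le_card_of_injOn (fun i => (i, J i))
    · intro i hi
      rw [mem_coe, mem_erase] at hi
      simp only [coe_filter, mem_univ, true_and, Set.mem_ofPred_eq]
      exact hJ i hi.1
    · intro i _ j _ hij
      exact congrArg Prod.fst hij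
  rw [← mul_assoc, ← pow_add, Nat.add_sub_cancel' hpos]
  have h1 : ∀ b, gg b = (if 0 < b then MM else 1) * wtqq b := by
    intro b
    unfold gg
    rcases Nat.eq_zero_or_pos b with h | h
    · subst h; simp [wtqq]
    · rw [if_neg (by omega), if_pos h]
  have h2 : MM ^ posCount n f * ∏ i, ∏ j, wtqq (f i j) = ∏ i, ∏ j, gg (f i j) := by
    simp only [h1, Finset.prod_mul_distrib]
    congr 1
    rw [← Finset.prod_product', Finset.univ_product_univ, ← Finset.prod_filter, Finset.prod_const]
    rfl
  rw [h2]
  unfold WW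
  have hg0 : gg 0 = 1 := by simp [gg]
  have h3 : ∀ i : Fin (n+1), ∏ j, gg (f i j) = (fun i : ℕ => ∏ j ∈ range (kk n G i), gg (ext n f i j)) i := by
    intro i
    rw [Finset.prod_congr rfl (fun j _ => congrArg gg (ext_val n f i j).symm),
      Fin.prod_univ_eq_prod_range (fun j => gg (ext n f i j)) (n+1)]
    symm
    apply Finset.prod_subset
    · intro x hx
      have := kk_le n G i
      rw [mem_range] at hx ⊢; omega
    · intro x _ hx
      have : ext n f i x = 0 := by
        by_contra h
        exact hx (mem_range.2 (hs _ _ h).2.2)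
      rw [this, hg0]
  rw [Finset.prod_congr rfl (fun i _ => h3 i),
    Fin.prod_univ_eq_prod_range (fun i : ℕ => ∏ j ∈ range (kk n G i), gg (ext n f i j)) (n+1)]
  symm
  apply Finset.prod_subset
  · intro x hx
    rw [mem_Icc] at hx; rw [mem_range]; omega
  · intro x hx1 hx
    rw [mem_range] at hx1
    rw [mem_Icc] at hx
    have h0 := kk_le n G x
    rw [show kk n G x = 0 by omega]
    simp

lemma MM_Ehr (n : ℕ) (G : SimpleGraph (Fin (n+1))) (hG : IsThreshold n G) (a : Fin (n+1) → ℕ)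
    (ha : ∀ i : Fin (n+1), i ≠ 0 → 0 < a i) :
    MM ^ n * Ehrqq n G a = EE (kk n G) n (aN n a) := by
  have hb := bij n G hG a
  have hfin : {f | IsFlow n G a f}.Finite := by
    apply Set.Finite.of_finite_image _ hb.injOn
    rw [hb.image_eq]
    exact Finset.finite_toSet _
  rw [← sum_FL _ (kk_le n G), ← finsum_mem_coe_finset, ← finsum_mem_eq_of_bijOn (ext n) hb
    (fun f hf => weight_eq n G hG a ha f hf)]
  unfold Ehrqq
  rw [finsum_mem_eq_finite_toFinset_sum _ hfin, finsum_mem_eq_finite_toFinset_sum _ hfin,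
    Finset.mul_sum]
  rfl

theorem ehr_qqinv_eq_prod (n : ℕ) (hn : 1 ≤ n) (G : SimpleGraph (Fin (n+1)))
    (hG : IsThreshold n G) (a : Fin (n+1) → ℕ)
    (ha : ∀ i : Fin (n+1), i ≠ 0 → 0 < a i) :
    Ehrqq n G a =
      LaurentPolynomial.T
          (-(((∑ i : Fin (n+1), min (deg n G i) (i : ℕ) * a i : ℕ) : ℤ) - n)) *
        ∏ i ∈ Finset.univ.erase (0 : Fin (n+1)), bpoly n G a i := by
  have hk := kk_le n G
  have hpos : ∀ i, 1 ≤ i → 0 < aN n a i := by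
    intro i hi
    unfold aN
    split_ifs with h
    · apply ha
      intro h0
      have := congrArg Fin.val h0
      simp at this
      omega
    · exact one_pos
  apply mul_left_cancel₀ (pow_ne_zero n MM_ne)
  rw [MM_Ehr n G hG a ha, EE_eq _ hk (kk2 n G hG) n _ hpos, mul_assoc]
  congr 2
  · congr 1
    have h1 : ∑ i : Fin (n+1), min (deg n G i) (i : ℕ) * a i =
        ∑ i ∈ Finset.Icc 1 n, kk n G i * aN n a i := by
      have h2 : ∀ i : Fin (n+1), min (deg n G i) (i : ℕ) * a i =
          (fun i : ℕ => kk n G i * aN n a i) i := by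
        intro i
        simp only [min_deg n G hG i, aN_val]
      rw [Finset.sum_congr rfl (fun i _ => h2 i),
        Fin.sum_univ_eq_sum_range (fun i : ℕ => kk n G i * aN n a i) (n+1)]
      symm
      apply Finset.sum_subset
      · intro x hx
        rw [mem_Icc] at hx; rw [mem_range]; omega
      · intro x hx1 hx
        rw [mem_range] at hx1
        rw [mem_Icc] at hx
        have h0 := hk x
        rw [show kk n G x = 0 by omega, zero_mul]
    rw [h1]
    push_cast
    ring
  · symm
    apply Finset.prod_bij (fun (i : Fin (n+1)) _ => (i : ℕ))
    · intro i hi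
      rw [mem_erase] at hi
      have hi0 : (i : ℕ) ≠ 0 := fun h0 => hi.1 (Fin.ext h0)
      rw [mem_Icc]; omega
    · intro i _ j _ h
      exact Fin.ext h
    · intro b hb
      rw [mem_Icc] at hb
      refine ⟨⟨b, by omega⟩, ?_, rfl⟩
      rw [mem_erase]
      refine ⟨?_, mem_univ _⟩
      intro h0
      have := congrArg Fin.val h0
      simp at this
      omega
    · intro i _
      exact bpoly_eq n G hG a i

end ThresholdFlow
end
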